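/- Let q be an odd prime power, d ≥ 2, and E ⊆ 𝔽_q^d with q^{(d+1)/2} ≤ |E|·(ln 2)/(2n). Then C_n ≤ |E|^{n+1}/q^n + (2n/ln 2)·q^{(d+1)/2}·|E|^n/q^n. -/

import Mathlib

/-- `C_n`: the number of unit-distance chains of length `n` in `E ⊆ 𝔽_q^d`, i.e. tuples
`(x^1, …, x^{n+1}) ∈ E^{n+1}` with `‖x^i − x^{i+1}‖ = 1` for `1 ≤ i ≤ n`,
where `‖x‖ = x_1^2 + ⋯ + x_d^2`. -/
def chainCount {F : Type} [Field F] [Fintype F] [DecidableEq F] {d : ℕ}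
    (E : Finset (Fin d → F)) (n : ℕ) : ℕ :=
  (Finset.univ.filter (fun x : Fin (n + 1) → (Fin d → F) =>
    (∀ i, x i ∈ E) ∧ ∀ i : Fin n, ∑ j, (x i.castSucc j - x i.succ j) ^ 2 = 1)).card

namespace Klo
open Polynomial QuadraticAlgebra
section bomb
variable {L : Type*} [Field L]

abbrev KA (a : L) (w : L[X]) := QuadraticAlgebra L[X] (-(C a)) w

def Dle {a : L} {w : L[X]} (q n : ℕ) (f : KA a w) : Prop :=
  f.re.degree ≤ n ∧ f.im.degree + q ≤ n

lemma Dle.mono {a : L} {w : L[X]} {q n m : ℕ} {f : KA a w} (h : Dle q n f) (hnm : n ≤ m) :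
    Dle q m f := by
  have : (n : WithBot ℕ) ≤ m := by exact_mod_cast hnm
  exact ⟨h.1.trans this, h.2.trans this⟩

lemma Dle.zero {a : L} {w : L[X]} {q n : ℕ} : Dle q n (0 : KA a w) := by
  simp [Dle]

lemma Dle.add {a : L} {w : L[X]} {q n : ℕ} {f g : KA a w} (hf : Dle q n f) (hg : Dle q n g) :
    Dle q n (f + g) := by
  refine ⟨(degree_add_le _ _).trans (max_le hf.1 hg.1), ?_⟩
  rcases le_total f.im.degree g.im.degree with h | h
  · exact (add_le_add_left ((degree_add_le _ _).trans (max_le h le_rfl)) _).trans hg.2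
  · exact (add_le_add_left ((degree_add_le _ _).trans (max_le le_rfl h)) _).trans hf.2

lemma Dle.sum {a : L} {w : L[X]} {q n : ℕ} {ι : Type*} (s : Finset ι) {f : ι → KA a w}
    (hf : ∀ i ∈ s, Dle q n (f i)) : Dle q n (∑ i ∈ s, f i) :=
  Finset.sum_induction _ _ (fun _ _ => Dle.add) Dle.zero hf

lemma Dle.mul {a : L} {w : L[X]} {q n m : ℕ} (hw : w.degree = q) {f g : KA a w}
    (hf : Dle q n f) (hg : Dle q m g) : Dle q (n + m) (f * g) := by
  obtain ⟨f1, f2⟩ := hf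
  obtain ⟨g1, g2⟩ := hg
  have key : (f.im * g.im).degree + q + q ≤ (n + m : ℕ) := by
    rw [degree_mul]; push_cast
    calc _ = (f.im.degree + q) + (g.im.degree + q) := by ac_rfl
      _ ≤ _ := add_le_add f2 g2
  have q0 : (0 : WithBot ℕ) ≤ q := by exact_mod_cast Nat.zero_le q
  have key1 : (f.im * g.im).degree + q ≤ (n + m : ℕ) :=
    (le_add_of_nonneg_right q0).trans key
  have key2 : (f.im * g.im).degree ≤ (n + m : ℕ) :=
    (le_add_of_nonneg_right q0).trans key1
  constructor
  · rw [re_mul]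
    refine (degree_add_le _ _).trans (max_le ?_ ?_)
    · rw [degree_mul]; push_cast; exact add_le_add f1 g1
    · rw [mul_assoc, degree_mul, degree_neg]
      calc _ ≤ 0 + (f.im * g.im).degree := add_le_add_left degree_C_le _
        _ ≤ _ := by simpa using key2
  · have hA : ∀ p r : L[X], p.degree + q ≤ (n+m : ℕ) → r.degree + q ≤ (n+m : ℕ) →
        (p + r).degree + q ≤ (n+m : ℕ) := by
      intro p r hp hr
      rcases le_total p.degree r.degree with h | h
      · exact (add_le_add_left ((degree_add_le _ _).trans (max_le h le_rfl)) _).trans hr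
      · exact (add_le_add_left ((degree_add_le _ _).trans (max_le le_rfl h)) _).trans hp
    rw [im_mul]
    refine hA _ _ (hA _ _ ?_ ?_) ?_
    · rw [degree_mul]; push_cast; rw [add_assoc]; exact add_le_add f1 g2
    · rw [degree_mul]; push_cast
      calc _ = (f.im.degree + q) + g.re.degree := by ac_rfl
        _ ≤ _ := add_le_add f2 g1
    · rw [mul_assoc, degree_mul, hw]
      calc _ = (f.im * g.im).degree + q + q := by ac_rfl
        _ ≤ _ := key

lemma Dle.star {a : L} {w : L[X]} {q n : ℕ} (hw : w.degree = q) {f : KA a w}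
    (hf : Dle q n f) : Dle q n (star f) := by
  refine ⟨?_, ?_⟩
  · rw [re_star]
    refine (degree_add_le _ _).trans (max_le hf.1 ?_)
    rw [degree_mul, hw, add_comm]; exact hf.2
  · rw [im_star, degree_neg]; exact hf.2

lemma Dle.alg {a : L} {w : L[X]} {q n : ℕ} (p : L[X]) (hp : p.degree ≤ n) :
    Dle q n (algebraMap L[X] (KA a w) p) := by
  refine ⟨by simpa using hp, by simp⟩

lemma Dle.omega_pow {a : L} {w : L[X]} {q : ℕ} (hw : w.degree = q) (k : ℕ) :
    Dle q (q * k) ((omega : KA a w) ^ k) := by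
  induction k with
  | zero =>
    have := Dle.alg (a := a) (w := w) (q := q) (n := 0) 1 (by simp)
    simpa using this
  | succ k ih =>
    rw [pow_succ, mul_add_one]
    refine ih.mul hw ⟨by simp, by simp⟩

lemma omega_mul_star {a : L} {w : L[X]} :
    (omega : KA a w) * star omega = algebraMap L[X] _ (C a) := by
  rw [← algebraMap_norm_eq_mul_star]; simp [norm_def]

lemma Dle.bal {a : L} {w : L[X]} {q : ℕ} (hw : w.degree = q) (I J M : ℕ) (h1 : I ≤ J + M)
    (h2 : J ≤ I + M) : Dle q (q * M) ((omega : KA a w) ^ I * (Star.star omega) ^ J) := by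
  have hc : ∀ k, Dle q 0 (((omega : KA a w) * Star.star omega) ^ k) := by
    intro k
    rw [omega_mul_star, ← map_pow, ← map_pow]
    exact Dle.alg _ degree_C_le
  rcases le_total I J with h | h
  · obtain ⟨k, rfl⟩ := Nat.exists_eq_add_of_le h
    rw [pow_add, ← mul_assoc, ← mul_pow, ← star_pow]
    have := (hc I).mul hw ((Dle.omega_pow (a := a) hw k).star hw)
    refine this.mono ?_
    rw [zero_add]; exact Nat.mul_le_mul_left _ (by omega)
  · obtain ⟨k, rfl⟩ := Nat.exists_eq_add_of_le h
    rw [pow_add, mul_right_comm, ← mul_pow]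
    have := (hc J).mul hw (Dle.omega_pow (a := a) hw k)
    refine this.mono ?_
    rw [zero_add]; exact Nat.mul_le_mul_left _ (by omega)

/-- The monomial `c x^I y^J`. -/
noncomputable def mon (a : L) (w : L[X]) (c : L) (I J : ℕ) : KA a w :=
  omega ^ I * algebraMap L[X] _ (C c * X ^ J)

lemma norm_mon_degree {a : L} {w : L[X]} {q : ℕ} (hw : w.degree = q) {ι : Type*} (s : Finset ι)
    (c : ι → L) (I J : ι → ℕ) (M T : ℕ) (hI : ∀ i ∈ s, I i ≤ M) (hJ : ∀ i ∈ s, J i ≤ T) :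
    (norm (∑ i ∈ s, mon a w (c i) (I i) (J i))).degree ≤ (q * M + 2 * T : ℕ) := by
  set f := ∑ i ∈ s, mon a w (c i) (I i) (J i) with hf
  have h : Dle q (q * M + 2 * T) (f * star f) := by
    rw [hf, star_sum, Finset.sum_mul_sum]
    refine Dle.sum _ fun i hi => Dle.sum _ fun j hj => ?_
    have e : mon a w (c i) (I i) (J i) * star (mon a w (c j) (I j) (J j)) =
        (omega ^ I i * star omega ^ I j) * (algebraMap L[X] _ (C (c i) * X ^ J i) *
          star (algebraMap L[X] (KA a w) (C (c j) * X ^ J j))) := by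
      simp only [mon, star_mul', star_pow]; ring
    rw [e]
    refine (Dle.bal hw _ _ M (by have := hI i hi; omega) (by have := hI j hj; omega)).mul hw ?_
    have d : ∀ k ∈ s, Dle q T (algebraMap L[X] (KA a w) (C (c k) * X ^ J k)) := by
      intro k hk
      apply Dle.alg
      refine (degree_C_mul_X_pow_le _ _).trans ?_
      exact_mod_cast hJ k hk
    rw [two_mul]
    exact (d i hi).mul hw ((d j hj).star hw)
  rw [← algebraMap_norm_eq_mul_star] at h
  simpa using h.1

lemma norm_ne_zero {a : L} {w : L[X]} (h2 : (2 : L) ≠ 0) (ha : a ≠ 0) (hw : 0 < w.natDegree)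
    (f : KA a w) (hf : f ≠ 0) : norm f ≠ 0 := by
  intro h0
  rw [norm_def] at h0
  set u := f.re
  set v := f.im
  have e : (2 * u + v * w) ^ 2 = v ^ 2 * (w ^ 2 - 4 * C a) := by linear_combination 4 * h0
  have hv : v ≠ 0 := by
    intro hv
    apply hf
    have : u = 0 := by simpa [hv] using h0
    ext1
    · exact this
    · exact hv
  have hd : v ∣ 2 * u + v * w := by
    exact (IsIntegrallyClosed.pow_dvd_pow_iff (n := 2) (by norm_num)).1 ⟨_, e⟩
  obtain ⟨r, hr⟩ := hd
  have e2 : (w - r) * (w + r) = C (4 * a) := by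
    have : v ^ 2 * (w ^ 2 - 4 * C a) = v ^ 2 * r ^ 2 := by rw [← e, hr]; ring
    have := mul_left_cancel₀ (pow_ne_zero 2 hv) this
    rw [Polynomial.C_mul]
    have h4 : (C (4:L) : L[X]) = 4 := rfl
    rw [h4]
    linear_combination this
  have h4a : (4 * a : L) ≠ 0 := by
    have : (4 : L) = 2 * 2 := by norm_num
    rw [this]; exact mul_ne_zero (mul_ne_zero h2 h2) ha
  have hu : IsUnit ((w - r) * (w + r)) := by
    rw [e2]; exact isUnit_C.2 h4a.isUnit
  have h1 := natDegree_eq_zero_of_isUnit (isUnit_of_mul_isUnit_left hu)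
  have h3 := natDegree_eq_zero_of_isUnit (isUnit_of_mul_isUnit_right hu)
  have h5 : (w - r + (w + r)).natDegree = 0 := by
    have := natDegree_add_le (w - r) (w + r)
    omega
  have h6 : w - r + (w + r) = C 2 * w := by
    have : (C (2:L) : L[X]) = 2 := rfl
    rw [this]; ring
  rw [h6, natDegree_C_mul h2] at h5
  omega

lemma omega_im_degree {a : L} {w : L[X]} {q : ℕ} (hq : 0 < q) (hw : w.degree = q) (n : ℕ) :
    ((omega : KA a w) ^ (n + 1)).im.degree = (q * n : ℕ) ∧
     ((omega : KA a w) ^ (n + 1)).re.degree < (q * n + q : ℕ) := by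
  induction n with
  | zero => simp
  | succ n ih =>
    rw [pow_succ]
    have h1 : ((omega : KA a w) ^ (n + 1) * omega).im =
      w * ((omega : KA a w) ^ (n + 1)).im + ((omega : KA a w) ^ (n + 1)).re := by
      simp [im_mul]; ring
    have h2 : ((omega : KA a w) ^ (n + 1) * omega).re =
      - (C a * ((omega : KA a w) ^ (n + 1)).im) := by
      simp [re_mul]
    have h3 : (w * ((omega : KA a w) ^ (n + 1)).im).degree = (q * (n + 1) : ℕ) := by
      rw [degree_mul, hw, ih.1]; norm_cast; ring
    constructor
    · rw [h1, degree_add_eq_left_of_degree_lt, h3]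
      rw [h3, mul_add_one]; exact ih.2
    · rw [h2, degree_neg, degree_mul, ih.1]
      calc _ ≤ (0 : WithBot ℕ) + (q * n : ℕ) := add_le_add_left degree_C_le _
        _ = (q * n : ℕ) := zero_add _
        _ < _ := by
          norm_cast
          nlinarith

lemma mon_im_degree {a : L} {w : L[X]} {q : ℕ} (hq : 0 < q) (hw : w.degree = q) (c : L)
    (hc : c ≠ 0) (I J : ℕ) (hI : 1 ≤ I) :
    (mon a w c I J).im.degree = (q * (I - 1) + J : ℕ) := by
  obtain ⟨n, rfl⟩ := Nat.exists_eq_add_of_le' hI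
  have : (mon a w c (n + 1) J).im = ((omega : KA a w) ^ (n + 1)).im * (C c * X ^ J) := by
    rw [mon, im_mul, algebraMap_re, algebraMap_im]; ring
  rw [this, degree_mul, (omega_im_degree hq hw n).1, degree_C_mul_X_pow _ hc]
  norm_cast

lemma sum_mon_ne_zero {a : L} {w : L[X]} {q : ℕ} (hq : 0 < q) (hw : w.degree = q) {ι : Type*}
    (s : Finset ι) (c : ι → L) (I J : ι → ℕ) (hI : ∀ i ∈ s, 1 ≤ I i)
    (hinj : ∀ i ∈ s, ∀ j ∈ s, q * (I i - 1) + J i = q * (I j - 1) + J j → i = j)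
    (hc : ∃ i ∈ s, c i ≠ 0) : ∑ i ∈ s, mon a w (c i) (I i) (J i) ≠ 0 := by
  classical
  intro h0
  have h1 : ∑ i ∈ s, (mon a w (c i) (I i) (J i)).im = 0 := by
    have := congrArg (imₗ (-(C a)) w) h0
    rw [map_sum, map_zero] at this
    exact this
  obtain ⟨i₀, hi₀, hc₀⟩ := hc
  obtain ⟨m, hm, hmax⟩ := Finset.exists_max_image (s.filter (fun i => c i ≠ 0))
    (fun i => q * (I i - 1) + J i) ⟨i₀, by simp [hi₀, hc₀]⟩
  rw [Finset.mem_filter] at hm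
  have hz : ∀ i ∈ s, c i = 0 → (mon a w (c i) (I i) (J i)).im = 0 := by
    intro i _ hi
    simp [mon, hi]
  rw [← Finset.add_sum_erase s _ hm.1] at h1
  have hlt : (∑ i ∈ s.erase m, (mon a w (c i) (I i) (J i)).im).degree <
      (mon a w (c m) (I m) (J m)).im.degree := by
    rw [mon_im_degree hq hw _ hm.2 _ _ (hI m hm.1)]
    refine (degree_sum_le _ _).trans_lt ?_
    rw [Finset.sup_lt_iff (WithBot.bot_lt_coe _)]
    intro i hi
    rw [Finset.mem_erase] at hi
    by_cases hci : c i = 0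
    · rw [hz i hi.2 hci, degree_zero]; exact WithBot.bot_lt_coe _
    · rw [mon_im_degree hq hw _ hci _ _ (hI i hi.2)]
      have := hmax i (by simp [hi.2, hci])
      have h2 : q * (I i - 1) + J i ≠ q * (I m - 1) + J m := fun h =>
        hi.1 (hinj i hi.2 m hm.1 h)
      exact_mod_cast lt_of_le_of_ne this h2
  have := degree_add_eq_left_of_degree_lt hlt
  rw [h1, degree_zero, mon_im_degree hq hw _ hm.2 _ _ (hI m hm.1)] at this
  exact absurd this (WithBot.bot_lt_coe _).ne

/-- Evaluation at a point of the curve. -/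
noncomputable def ev {a : L} {w : L[X]} (x y : L) (h : x ^ 2 - w.eval y * x + a = 0) :
    KA a w →+* L where
  toFun f := f.re.eval y + f.im.eval y * x
  map_one' := by simp
  map_zero' := by simp
  map_add' f g := by simp; ring
  map_mul' f g := by
    simp [re_mul, im_mul]
    linear_combination (-(f.im.eval y * g.im.eval y)) * h

lemma ev_apply {a : L} {w : L[X]} (x y : L) (h : x ^ 2 - w.eval y * x + a = 0) (f : KA a w) :
    ev x y h f = f.re.eval y + f.im.eval y * x := rfl

lemma ev_mon {a : L} {w : L[X]} (x y : L) (h : x ^ 2 - w.eval y * x + a = 0) (c : L) (I J : ℕ) :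
    ev x y h (mon a w c I J) = c * x ^ I * y ^ J := by
  rw [mon, map_mul, map_pow, ev_apply, ev_apply, algebraMap_re, algebraMap_im]
  simp; ring

lemma mon_smul {a : L} {w : L[X]} (c : L) (I J : ℕ) : mon a w c I J = c • mon a w 1 I J := by
  rw [mon, mon, ← smul_eq_C_mul, Polynomial.C_1, one_mul]
  ext1 <;> simp [re_mul, im_mul, algebraMap_re, algebraMap_im, -map_smul, -map_pow]

open Classical in
lemma card_points_le [Fintype L] {a : L} {w : L[X]} (f : KA a w) (hf : norm f ≠ 0)
    (hv : ∀ (x y : L) (h : x ^ 2 - w.eval y * x + a = 0), ev x y h f = 0) :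
    (Finset.univ.filter (fun p : L × L => p.1 ^ 2 - w.eval p.2 * p.1 + a = 0)).card ≤
      (norm f).natDegree := by
  have hfib : ∀ y : L, (Finset.univ.filter (fun x : L => x ^ 2 - w.eval y * x + a = 0)).card ≤
      (norm f).roots.count y := by
    intro y
    rw [count_roots]
    set Fb := (Finset.univ.filter (fun x : L => x ^ 2 - w.eval y * x + a = 0)) with hFb
    have hmem : ∀ x, x ∈ Fb ↔ x ^ 2 - w.eval y * x + a = 0 := by intro x; simp [hFb]
    rcases Nat.lt_or_ge 1 Fb.card with h1 | h1
    · have h2 : Fb.card ≤ 2 := by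
        by_contra hlt
        push Not at hlt
        obtain ⟨x, hx, z, hz, t, ht, hxz, hxt, hzt⟩ := Finset.two_lt_card.1 hlt
        rw [hmem] at hx hz ht
        have e1 : (x - z) * (x + z - w.eval y) = 0 := by linear_combination hx - hz
        have e2 : (x - t) * (x + t - w.eval y) = 0 := by linear_combination hx - ht
        have e1' := (mul_eq_zero.1 e1).resolve_left (sub_ne_zero.2 hxz)
        have e2' := (mul_eq_zero.1 e2).resolve_left (sub_ne_zero.2 hxt)
        exact hzt (by linear_combination e1' - e2')
      obtain ⟨x, hx, z, hz, hxz⟩ := Finset.one_lt_card.1 h1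
      rw [hmem] at hx hz
      have hx' := hv x y hx
      have hz' := hv z y hz
      rw [ev_apply] at hx' hz'
      have him : f.im.eval y = 0 := by
        have : f.im.eval y * (x - z) = 0 := by linear_combination hx' - hz'
        exact (mul_eq_zero.1 this).resolve_right (sub_ne_zero.2 hxz)
      have hre : f.re.eval y = 0 := by simpa [him] using hx'
      obtain ⟨u, hu⟩ := dvd_iff_isRoot.2 him
      obtain ⟨v, hv⟩ := dvd_iff_isRoot.2 hre
      refine h2.trans ((le_rootMultiplicity_iff hf).2 ?_)
      rw [norm_def, hu, hv]
      exact ⟨v * v + w * v * u - -C a * u * u, by ring⟩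
    · rcases Nat.eq_zero_or_pos Fb.card with h0 | h0
      · omega
      · obtain ⟨x, hx⟩ := Finset.card_pos.1 h0
        rw [hmem] at hx
        have hx' := hv x y hx
        rw [ev_apply] at hx'
        refine h1.trans ?_
        rw [Nat.one_le_iff_ne_zero, ← Nat.pos_iff_ne_zero, rootMultiplicity_pos hf, IsRoot.def,
          norm_def]
        simp only [eval_sub, eval_add, eval_mul, eval_neg, eval_C]
        linear_combination (f.re.eval y - f.im.eval y * x + w.eval y * f.im.eval y) * hx' +
          (f.im.eval y) ^ 2 * hx
  calc _ = ∑ y : L, (Finset.univ.filter (fun x : L => x ^ 2 - w.eval y * x + a = 0)).card := by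
        rw [Finset.card_eq_sum_card_fiberwise (f := Prod.snd) (t := Finset.univ) (by simp)]
        refine Finset.sum_congr rfl fun y _ => ?_
        refine Finset.card_bij' (fun p _ => p.1) (fun x _ => (x, y)) ?_ ?_ ?_ ?_
        · rintro ⟨x, z⟩ h; simp at h ⊢; rw [← h.2]; exact h.1
        · intro x h; simpa using h
        · rintro ⟨x, z⟩ h; simp at h ⊢; exact h.2.symm
        · simp
    _ ≤ ∑ y : L, (norm f).roots.count y := Finset.sum_le_sum fun y _ => hfib y
    _ = (norm f).roots.card := Multiset.sum_count_eq_card (by simp)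
    _ ≤ _ := card_roots' _

/-- Auxiliary coefficient map. -/
def coefMap (a : L) (w : L[X]) (n : ℕ) : KA a w →ₗ[L] (Fin (n + 1) → L) × (Fin (n + 1) → L) where
  toFun f := (fun i => f.re.coeff i, fun i => f.im.coeff i)
  map_add' f g := by ext <;> simp
  map_smul' c f := by ext <;> simp

lemma eq_zero_of_coefMap {a : L} {w : L[X]} {q n : ℕ} (f : KA a w) (hf : Dle q n f)
    (h : coefMap a w n f = 0) : f = 0 := by
  have h1 := congrArg Prod.fst h
  have h2 := congrArg Prod.snd h
  have key : ∀ p : L[X], p.degree ≤ n → (∀ i : Fin (n + 1), p.coeff i = 0) → p = 0 := by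
    intro p hp hc
    ext i
    rcases Nat.lt_or_ge i (n + 1) with hi | hi
    · simpa using hc ⟨i, hi⟩
    · rw [coeff_zero]
      apply coeff_eq_zero_of_degree_lt
      refine hp.trans_lt ?_
      exact_mod_cast hi
  ext1
  · exact key _ hf.1 (fun i => congrFun h1 i)
  · refine key _ (le_trans ?_ hf.2) (fun i => congrFun h2 i)
    exact le_add_of_nonneg_right (by exact_mod_cast Nat.zero_le q)

open Classical in
theorem bombieri [Fintype L] (h2 : (2 : L) ≠ 0) (q s' : ℕ) (hq : 3 ≤ q) (hs' : 1 ≤ s')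
    (a : L) (ha : a ≠ 0) (w : L[X]) (hw : w.degree = q) (φ : L →+* L)
    (hφ : ∀ x, φ x = x ^ (q * s')) (hcard : Fintype.card L = (q * s') * (q * s')) :
    (Finset.univ.filter (fun p : L × L => p.1 ^ 2 - w.eval p.2 * p.1 + a = 0)).card ≤
      (q * s') * (q * s') + 8 * q * (q * s') := by
  set s := q * s' with hs
  have hs3 : 3 ≤ s := by nlinarith
  have hqs : q ≤ s := by nlinarith
  set K := s + 3 * q with hK
  have hfrob : ∀ x : L, x ^ (s * s) = x := by
    intro x; rw [← hcard]; exact FiniteField.pow_card x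
  set M' := s * (s' - 1) + s' + 3 with hM'
  set h := (M' + 1) / 2 with hh
  set T := s * (q - 1) + (q - 1) with hT
  set n := q * h + T with hn
  -- bounds on indices
  have hkdiv : ∀ k : Fin K, (k : ℕ) / q ≤ s' + 2 := by
    intro k
    have : (k : ℕ) / q < s' + 3 := by
      rw [Nat.div_lt_iff_lt_mul (by omega)]
      have := k.2
      calc (k : ℕ) < K := this
        _ = (s' + 3) * q := by rw [hK, hs]; ring
    omega
  have hldiv : ∀ l : Fin s, (l : ℕ) / q ≤ s' - 1 := by
    intro l
    have : (l : ℕ) / q < s' := by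
      rw [Nat.div_lt_iff_lt_mul (by omega)]
      have := l.2
      calc (l : ℕ) < s := this
        _ = s' * q := by rw [hs]; ring
    omega
  have hmod : ∀ k : ℕ, k % q ≤ q - 1 := by
    intro k; have := Nat.mod_lt k (show q > 0 by omega); omega
  let V : Fin K × Fin s → KA a w := fun p =>
    mon a w 1 (s * (p.2 / q) + 1 + p.1 / q) (s * (p.2 % q) + p.1 % q)
  have hVD : ∀ p, Dle q n (star (omega : KA a w) ^ h * V p) := by
    intro p
    have e : star (omega : KA a w) ^ h * V p =
      (omega ^ (s * (p.2 / q) + 1 + p.1 / q) * star omega ^ h) *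
        algebraMap L[X] _ (C 1 * X ^ (s * (p.2 % q) + p.1 % q)) := by
      simp only [V, mon]; ring
    rw [e, hn]
    have i1 : s * ((p.2 : ℕ) / q) ≤ s * (s' - 1) := Nat.mul_le_mul_left _ (hldiv p.2)
    have i2 := hkdiv p.1
    have i3 : s * ((p.2 : ℕ) % q) ≤ s * (q - 1) := Nat.mul_le_mul_left _ (hmod _)
    have i4 := hmod p.1
    have i5 : s * ((p.2 : ℕ) / q) + 1 + p.1 / q ≤ h + h := by
      generalize (p.1 : ℕ) / q = u at *
      omega
    refine (Dle.bal hw _ _ h i5 (Nat.le_add_left _ _)).mul hw (Dle.alg _ ?_)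
    refine (degree_C_mul_X_pow_le _ _).trans ?_
    have : s * ((p.2 : ℕ) % q) + p.1 % q ≤ T := by omega
    exact_mod_cast this
  have hdim : 2 * (n + 1) < K * s := by
    obtain ⟨t, rfl⟩ := Nat.exists_eq_add_of_le' hs'
    obtain ⟨r, hr⟩ := Nat.exists_eq_add_of_le' (show 1 ≤ q by omega)
    have e1 : q * (2 * h) ≤ q * (M' + 1) := Nat.mul_le_mul_left _ (by omega)
    have e2 : q * (M' + 1) = s * s + s + 4 * q - q * s := by
      rw [hM', show t + 1 - 1 = t by omega]
      apply Nat.eq_sub_of_add_eq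
      have : q * s = q * s := rfl
      rw [show s = q * (t + 1) from rfl]; ring
    have e3 : q * s ≤ s * s := Nat.mul_le_mul_right _ hqs
    have e4 : T = q * s - s + (q - 1) := by rw [hT, Nat.mul_sub_one, mul_comm]
    have e5 : K * s = s * s + 3 * (q * s) := by rw [hK]; ring
    have e6 : s ≤ q * s := Nat.le_mul_of_pos_left _ (by omega)
    have e7 : 3 * q ≤ q * s := by rw [mul_comm]; exact Nat.mul_le_mul_left _ hs3
    have e8 : 2 * (n + 1) = q * (2 * h) + 2 * T + 2 := by rw [hn]; ring
    generalize q * s = A at *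
    generalize s * s = B at *
    omega
  obtain ⟨γ, hγ0, i₀, hi₀⟩ : ∃ γ : Fin K × Fin s → L,
      ∑ p, γ p • coefMap a w n (star (omega : KA a w) ^ h * V p) = 0 ∧ ∃ p, γ p ≠ 0 := by
    rw [← Fintype.not_linearIndependent_iff]
    intro hli
    have := hli.fintype_card_le_finrank
    simp at this
    omega
  have hrel : ∑ p, γ p • V p = 0 := by
    have h1 : star (omega : KA a w) ^ h * ∑ p, γ p • V p = 0 := by
      have e : star (omega : KA a w) ^ h * ∑ p, γ p • V p =
          ∑ p, γ p • (star (omega : KA a w) ^ h * V p) := by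
        rw [Finset.mul_sum]
        exact Finset.sum_congr rfl fun p _ => mul_smul_comm _ _ _
      rw [e]
      refine eq_zero_of_coefMap (q := q) (n := n) _ (Dle.sum _ fun p _ => ?_) ?_
      · have hd := hVD p
        refine ⟨(degree_smul_le _ _).trans hd.1, le_trans ?_ hd.2⟩
        exact add_le_add_left (degree_smul_le _ _) _
      · rw [map_sum, ← hγ0]
        exact Finset.sum_congr rfl fun p _ => map_smul _ _ _
    have h3 : algebraMap L[X] (KA a w) (C a) ^ h * ∑ p, γ p • V p = 0 := by
      rw [← omega_mul_star, mul_pow, mul_assoc, h1, mul_zero]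
    rw [← map_pow, ← Algebra.smul_def, ← Polynomial.C_pow] at h3
    have hah : a ^ h ≠ 0 := pow_ne_zero _ ha
    have h4 : C ((a ^ h)⁻¹) • (C (a ^ h) • ∑ p, γ p • V p) = 0 := by rw [h3, smul_zero]
    rwa [smul_smul, ← Polynomial.C_mul, inv_mul_cancel₀ hah, Polynomial.C_1, one_smul] at h4
  have hsurj : Function.Surjective φ := Finite.injective_iff_surjective.1 φ.injective
  choose c hc using fun p => hsurj (γ p)
  let II : Fin K × Fin s → ℕ := fun p => p.2 / q + s * (1 + p.1 / q)
  let JJ : Fin K × Fin s → ℕ := fun p => p.2 % q + s * (p.1 % q)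
  have hwt : ∀ p, q * (II p - 1) + JJ p = (p.2 + s * p.1) + q * (s - 1) := by
    intro p
    have e0 : II p - 1 = p.2 / q + s * (p.1 / q) + (s - 1) := by
      simp only [II]; rw [mul_add, mul_one]
      generalize (p.2 : ℕ) / q = u
      omega
    have d1 := Nat.div_add_mod (p.2 : ℕ) q
    have d2 := Nat.div_add_mod (p.1 : ℕ) q
    rw [e0]
    calc _ = (q * ((p.2 : ℕ) / q) + p.2 % q) + s * (q * ((p.1 : ℕ) / q) + p.1 % q)
          + q * (s - 1) := by simp only [JJ]; ring
      _ = _ := by rw [d1, d2]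
  have hR : ∑ p, mon a w (c p) (II p) (JJ p) ≠ 0 := by
    refine sum_mon_ne_zero (q := q) (by omega) hw _ _ _ _ ?_ ?_ ⟨i₀, Finset.mem_univ _, ?_⟩
    · intro p _
      simp only [II]; rw [mul_add, mul_one]
      generalize (p.2 : ℕ) / q = u
      omega
    · intro p _ r _ hpr
      rw [hwt, hwt] at hpr
      have hpr' : (p.2 : ℕ) + s * p.1 = r.2 + s * r.1 := by omega
      have m1 := congrArg (· % s) hpr'
      simp only [Nat.add_mul_mod_self_left, Nat.mod_eq_of_lt p.2.2, Nat.mod_eq_of_lt r.2.2] at m1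
      have m2 : (p.1 : ℕ) = r.1 := by
        rw [m1] at hpr'
        exact Nat.eq_of_mul_eq_mul_left (by omega) (Nat.add_left_cancel hpr')
      exact Prod.ext (Fin.ext m2) (Fin.ext m1)
    · intro h0
      rw [← hc, h0, map_zero] at hi₀
      exact hi₀ rfl
  have hwn : w.natDegree = q := natDegree_eq_of_degree_eq_some hw
  refine (card_points_le _ (norm_ne_zero h2 ha (by omega) _ hR) ?_).trans ?_
  · intro x y hxy
    apply φ.injective
    rw [map_zero, map_sum, map_sum, ← map_zero (ev x y hxy), ← hrel, map_sum]
    refine Finset.sum_congr rfl fun p _ => ?_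
    simp only [V]
    rw [← mon_smul, ev_mon, ev_mon, map_mul, map_mul, hc, map_pow, map_pow, hφ x, hφ y]
    have ex : (x ^ s) ^ (II p) = x ^ (s * (p.2 / q) + 1 + p.1 / q) := by
      rw [← pow_mul]; simp only [II]
      rw [mul_add, ← mul_assoc, pow_add, pow_mul x (s * s), hfrob, ← pow_add, add_assoc]
    have ey : (y ^ s) ^ (JJ p) = y ^ (s * (p.2 % q) + p.1 % q) := by
      rw [← pow_mul]; simp only [JJ]
      rw [mul_add, ← mul_assoc, pow_add, pow_mul y (s * s), hfrob, ← pow_add]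
    rw [ex, ey]
  · refine natDegree_le_of_degree_le ((norm_mon_degree hw _ _ _ _ ((s' - 1) + s * (s' + 3))
      ((q - 1) + s * (q - 1)) ?_ ?_).trans ?_)
    · intro p _
      exact Nat.add_le_add (hldiv _) (Nat.mul_le_mul_left _ (by have := hkdiv p.1; omega))
    · intro p _
      exact Nat.add_le_add (hmod _) (Nat.mul_le_mul_left _ (hmod _))
    · norm_cast
      have e1 : q * (s' - 1 + s * (s' + 3)) = (s - q) + s * s + 3 * (q * s) := by
        rw [mul_add, Nat.mul_sub_one, show q * s' = s from rfl, add_assoc]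
        congr 1
        rw [show s = q * s' from rfl]; ring
      have e2 : s * (q - 1) = q * s - s := by rw [Nat.mul_sub_one, mul_comm]
      rw [e1, e2]
      have e6 : s ≤ q * s := Nat.le_mul_of_pos_left _ (by omega)
      rw [show 8 * q * s = 8 * (q * s) by ring]
      generalize q * s = A at *
      generalize s * s = B at *
      omega

end bomb
end Klo

namespace Klo
open Polynomial
section lfun
variable {F : Type*} [Field F] [Fintype F]

open Classical in
/-- The multiplicative function attached to the Kloosterman sum. -/
noncomputable def Lam (ψ : AddChar F ℂ) (a : F) (f : F[X]) : ℂ :=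
  if f.coeff 0 = 0 then 0 else ψ (-f.nextCoeff - a * (f.coeff 1 / f.coeff 0))

lemma Lam_mul (ψ : AddChar F ℂ) (a : F) {f g : F[X]} (hf : f.Monic) (hg : g.Monic) :
    Lam ψ a (f * g) = Lam ψ a f * Lam ψ a g := by
  unfold Lam
  by_cases h1 : f.coeff 0 = 0
  · simp [h1, mul_coeff_zero]
  by_cases h2 : g.coeff 0 = 0
  · simp [h2, mul_coeff_zero]
  rw [if_neg h1, if_neg h2, if_neg (by rw [mul_coeff_zero]; exact mul_ne_zero h1 h2),
    hf.nextCoeff_mul hg, mul_coeff_one, mul_coeff_zero, ← AddChar.map_add_eq_mul]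
  congr 1
  field_simp
  ring

lemma Lam_one (ψ : AddChar F ℂ) (a : F) : Lam ψ a 1 = 1 := by
  have h : (1 : F[X]).nextCoeff = 0 := by
    rw [← Polynomial.C_1, nextCoeff_C_eq_zero]
  simp [Lam, h, coeff_one]

lemma Lam_pow (ψ : AddChar F ℂ) (a : F) {f : F[X]} (hf : f.Monic) (n : ℕ) :
    Lam ψ a (f ^ n) = Lam ψ a f ^ n := by
  induction n with
  | zero => simp [Lam_one]
  | succ n ih => rw [pow_succ, Lam_mul ψ a (hf.pow n) hf, ih, pow_succ]

lemma finite_monic (n : ℕ) : {f : F[X] | f.Monic ∧ f.natDegree = n}.Finite := by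
  refine Set.Finite.of_injOn (f := fun f : F[X] => (fun i : Fin (n + 1) => f.coeff i))
    (t := Set.univ) (fun _ _ => Set.mem_univ _) ?_ Set.finite_univ
  intro f hf g hg hfg
  ext i
  rcases Nat.lt_or_ge i (n + 1) with hi | hi
  · exact congrFun hfg ⟨i, hi⟩
  · rw [coeff_eq_zero_of_natDegree_lt (by rw [hf.2]; exact hi),
      coeff_eq_zero_of_natDegree_lt (by rw [hg.2]; exact hi)]

/-- Monic polynomials of degree `n`. -/
noncomputable def Mon (F : Type*) [Field F] [Fintype F] (n : ℕ) : Finset F[X] :=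
  (finite_monic (F := F) n).toFinset

lemma mem_Mon {n : ℕ} {f : F[X]} : f ∈ Mon F n ↔ f.Monic ∧ f.natDegree = n := by
  simp [Mon]

open Classical in
noncomputable def Irr (F : Type*) [Field F] [Fintype F] (n : ℕ) : Finset F[X] :=
  (Mon F n).filter Irreducible

lemma mem_Irr {n : ℕ} {f : F[X]} : f ∈ Irr F n ↔ (f.Monic ∧ f.natDegree = n) ∧ Irreducible f := by
  simp [Irr, mem_Mon]

noncomputable def SS (ψ : AddChar F ℂ) (a : F) (n : ℕ) : ℂ := ∑ f ∈ Mon F n, Lam ψ a f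

noncomputable def KK (ψ : AddChar F ℂ) (a : F) (j : ℕ) : ℂ :=
  ∑ x ∈ j.divisorsAntidiagonal, ∑ P ∈ Irr F x.1, (x.1 : ℂ) * Lam ψ a P ^ x.2

open Classical in
lemma degree_sum {n : ℕ} {f : F[X]} (hf : f.Monic) (hn : f.natDegree = n) :
    ∑ d ∈ Finset.Icc 1 n, ∑ P ∈ Irr F d, ∑ m ∈ Finset.Icc 1 n, (if P ^ m ∣ f then d else 0) = n := by
  have hf0 := hf.ne_zero
  have hcount : ∀ d ∈ Finset.Icc 1 n, ∀ P ∈ Irr F d,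
      ∑ m ∈ Finset.Icc 1 n, (if P ^ m ∣ f then d else 0) =
        (UniqueFactorizationMonoid.normalizedFactors f).count P * P.natDegree := by
    intro d hd P hP
    rw [mem_Irr] at hP
    obtain ⟨⟨hPm, hPd⟩, hPi⟩ := hP
    rw [Finset.mem_Icc] at hd
    have hm : ∀ m, P ^ m ∣ f ↔ m ≤ (UniqueFactorizationMonoid.normalizedFactors f).count P := by
      intro m
      rw [pow_dvd_iff_le_emultiplicity,
        UniqueFactorizationMonoid.emultiplicity_eq_count_normalizedFactors hPi hf0,
        hPm.normalize_eq_self]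
      exact Nat.cast_le
    set c := (UniqueFactorizationMonoid.normalizedFactors f).count P with hc
    have hcn : c ≤ n := by
      have := (hm c).2 le_rfl
      have := natDegree_le_of_dvd this hf0
      rw [natDegree_pow, hPd, hn] at this
      nlinarith
    rw [← Finset.sum_filter]
    have : (Finset.Icc 1 n).filter (fun m => P ^ m ∣ f) = Finset.Icc 1 c := by
      ext m; simp only [Finset.mem_filter, Finset.mem_Icc, hm]; omega
    rw [this, hPd]; simp
  rw [Finset.sum_congr rfl fun d hd => Finset.sum_congr rfl fun P hP => hcount d hd P hP]
  have hfac : ∀ P ∈ UniqueFactorizationMonoid.normalizedFactors f, P.Monic ∧ Irreducible P ∧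
      P.natDegree ∈ Finset.Icc 1 n := by
    intro P hP
    have hi := UniqueFactorizationMonoid.irreducible_of_normalized_factor P hP
    refine ⟨?_, hi, ?_⟩
    · have := UniqueFactorizationMonoid.normalize_normalized_factor P hP
      rw [← this]; exact monic_normalize hi.ne_zero
    · rw [Finset.mem_Icc]
      refine ⟨hi.natDegree_pos, ?_⟩
      rw [← hn]
      exact natDegree_le_of_dvd (UniqueFactorizationMonoid.dvd_of_mem_normalizedFactors hP) hf0
  have hprod : (UniqueFactorizationMonoid.normalizedFactors f).prod = f := by
    rw [UniqueFactorizationMonoid.prod_normalizedFactors_eq hf0, hf.normalize_eq_self]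
  have hdeg : ((UniqueFactorizationMonoid.normalizedFactors f).map natDegree).sum = n := by
    rw [← natDegree_multiset_prod_of_monic _ (fun P hP => (hfac P hP).1), hprod, hn]
  rw [Finset.sum_multiset_map_count] at hdeg
  refine Eq.trans ?_ hdeg
  rw [Finset.sum_sigma']
  symm
  simp only [smul_eq_mul]
  refine Finset.sum_of_injOn (fun P => ⟨P.natDegree, P⟩) ?_ ?_ ?_ ?_
  · intro P _ R _ h
    simpa using (Sigma.mk.inj h).2
  · intro P hP
    have := hfac P (Multiset.mem_toFinset.1 (Finset.mem_coe.1 hP))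
    simp only [Finset.coe_sigma, Set.mem_sigma_iff, Finset.mem_coe]
    exact ⟨this.2.2, mem_Irr.2 ⟨⟨this.1, rfl⟩, this.2.1⟩⟩
  · rintro ⟨d, P⟩ hP hP'
    simp only [Finset.mem_sigma, mem_Irr] at hP
    have : P ∉ UniqueFactorizationMonoid.normalizedFactors f := by
      intro hmem
      apply hP'
      refine ⟨P, Finset.mem_coe.2 (Multiset.mem_toFinset.2 hmem), ?_⟩
      simp [hP.2.1.2]
    simp [Multiset.count_eq_zero_of_notMem this]
  · intro P _; rfl

open Classical in
lemma sum_dvd (ψ : AddChar F ℂ) (a : F) {n d m : ℕ} {P : F[X]} (hP : P.Monic)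
    (hd : P.natDegree = d) :
    ∑ f ∈ Mon F n, (if P ^ m ∣ f then Lam ψ a f else 0) =
      if m * d ≤ n then Lam ψ a P ^ m * SS ψ a (n - m * d) else 0 := by
  have hPm := hP.pow m
  have hdeg : (P ^ m).natDegree = m * d := by rw [natDegree_pow, hd]
  split_ifs with h
  · rw [← Finset.sum_filter, SS, Finset.mul_sum]
    symm
    refine Finset.sum_bij (fun g _ => P ^ m * g) ?_ ?_ ?_ ?_
    · intro g hg
      rw [mem_Mon] at hg
      rw [Finset.mem_filter, mem_Mon]
      refine ⟨⟨hPm.mul hg.1, ?_⟩, dvd_mul_right _ _⟩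
      rw [hPm.natDegree_mul hg.1, hdeg, hg.2]; omega
    · intro g _ g' _ h
      exact mul_left_cancel₀ hPm.ne_zero h
    · intro f hf
      rw [Finset.mem_filter, mem_Mon] at hf
      obtain ⟨⟨hfm, hfn⟩, g, rfl⟩ := hf
      have hg : g.Monic := hPm.of_mul_monic_left hfm
      refine ⟨g, mem_Mon.2 ⟨hg, ?_⟩, rfl⟩
      rw [hPm.natDegree_mul hg, hdeg] at hfn; omega
    · intro g hg
      rw [mem_Mon] at hg
      rw [Lam_mul ψ a hPm hg.1, Lam_pow ψ a hP]
  · refine Finset.sum_eq_zero fun f hf => ?_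
    rw [mem_Mon] at hf
    rw [if_neg]
    intro hdv
    have := natDegree_le_of_dvd hdv hf.1.ne_zero
    omega

lemma newton (ψ : AddChar F ℂ) (a : F) (n : ℕ) :
    (n : ℂ) * SS ψ a n = ∑ j ∈ Finset.Icc 1 n, KK ψ a j * SS ψ a (n - j) := by
  classical
  calc (n : ℂ) * SS ψ a n
      = ∑ f ∈ Mon F n, ∑ d ∈ Finset.Icc 1 n, ∑ P ∈ Irr F d, ∑ m ∈ Finset.Icc 1 n,
          (d : ℂ) * (if P ^ m ∣ f then Lam ψ a f else 0) := by
        rw [SS, Finset.mul_sum]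
        refine Finset.sum_congr rfl fun f hf => ?_
        rw [mem_Mon] at hf
        have e : (n : ℂ) = ((∑ d ∈ Finset.Icc 1 n, ∑ P ∈ Irr F d, ∑ m ∈ Finset.Icc 1 n,
            (if P ^ m ∣ f then d else 0) : ℕ) : ℂ) := by rw [degree_sum hf.1 hf.2]
        refine (congrArg (· * Lam ψ a f) e).trans ?_
        push_cast
        simp only [Finset.sum_mul]
        refine Finset.sum_congr rfl fun d _ => Finset.sum_congr rfl fun P _ =>
          Finset.sum_congr rfl fun m _ => ?_
        split_ifs <;> simp
    _ = ∑ d ∈ Finset.Icc 1 n, ∑ m ∈ Finset.Icc 1 n, if m * d ≤ n then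
          ∑ P ∈ Irr F d, (d : ℂ) * Lam ψ a P ^ m * SS ψ a (n - m * d) else 0 := by
        rw [Finset.sum_comm]
        refine Finset.sum_congr rfl fun d _ => ?_
        rw [Finset.sum_comm]
        rw [Finset.sum_congr rfl fun P _ => Finset.sum_comm, Finset.sum_comm]
        refine Finset.sum_congr rfl fun m _ => ?_
        have : ∀ P ∈ Irr F d, ∑ f ∈ Mon F n, (d : ℂ) * (if P ^ m ∣ f then Lam ψ a f else 0) =
            if m * d ≤ n then (d : ℂ) * Lam ψ a P ^ m * SS ψ a (n - m * d) else 0 := by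
          intro P hP
          rw [mem_Irr] at hP
          rw [← Finset.mul_sum, sum_dvd ψ a hP.1.1 hP.1.2]
          split_ifs <;> ring
        rw [Finset.sum_congr rfl this]
        split_ifs <;> simp
    _ = ∑ j ∈ Finset.Icc 1 n, ∑ x ∈ j.divisorsAntidiagonal,
          ∑ P ∈ Irr F x.1, (x.1 : ℂ) * Lam ψ a P ^ x.2 * SS ψ a (n - j) := by
        rw [← Finset.sum_product', ← Finset.sum_filter, Finset.sum_sigma' (Finset.Icc 1 n)
          (fun j => j.divisorsAntidiagonal)]
        refine Finset.sum_bij' (fun x _ => ⟨x.2 * x.1, x⟩) (fun y _ => y.2) ?_ ?_ ?_ ?_ ?_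
        · rintro ⟨d, m⟩ h
          simp only [Finset.mem_filter, Finset.mem_product, Finset.mem_Icc] at h
          simp only [Finset.mem_sigma, Finset.mem_Icc, Nat.mem_divisorsAntidiagonal]
          have : 1 ≤ m * d := Nat.mul_pos (by omega) (by omega)
          exact ⟨⟨this, h.2⟩, mul_comm _ _, by omega⟩
        · rintro ⟨j, d, m⟩ h
          simp only [Finset.mem_sigma, Finset.mem_Icc, Nat.mem_divisorsAntidiagonal] at h
          obtain ⟨⟨h1, h2⟩, h3, h4⟩ := h
          simp only [Finset.mem_filter, Finset.mem_product, Finset.mem_Icc]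
          have hd : 1 ≤ d := Nat.one_le_iff_ne_zero.2 (by rintro rfl; simp at h3; omega)
          have hm : 1 ≤ m := Nat.one_le_iff_ne_zero.2 (by rintro rfl; simp at h3; omega)
          refine ⟨⟨⟨hd, ?_⟩, ⟨hm, ?_⟩⟩, ?_⟩ <;> nlinarith
        · intro x _; rfl
        · rintro ⟨j, d, m⟩ h
          simp only [Finset.mem_sigma, Nat.mem_divisorsAntidiagonal] at h
          simp only [Sigma.mk.injEq, heq_eq_eq, and_true]
          rw [mul_comm]; exact h.2.1
        · intro x _; rfl
    _ = _ := by
        refine Finset.sum_congr rfl fun j _ => ?_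
        rw [KK, Finset.sum_mul]
        exact Finset.sum_congr rfl fun x _ => by rw [Finset.sum_mul]

lemma SS_zero (ψ : AddChar F ℂ) (a : F) : SS ψ a 0 = 1 := by
  have : Mon F 0 = {1} := by
    ext f
    rw [mem_Mon, Finset.mem_singleton]
    constructor
    · rintro ⟨h1, h2⟩; exact h1.natDegree_eq_zero.1 h2
    · rintro rfl; simp [monic_one]
  simp [SS, this, Lam_one]

lemma SS_ge_three (ψ : AddChar F ℂ) (hψ : ψ ≠ 1) (a : F) (n : ℕ) (hn : 3 ≤ n) :
    SS ψ a n = 0 := by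
  obtain ⟨t, ht⟩ := AddChar.ne_one_iff.1 hψ
  have hdeg : ∀ (t : F) (f : F[X]), f.Monic ∧ f.natDegree = n →
      (f + C t * X ^ (n - 1)).Monic ∧ (f + C t * X ^ (n - 1)).natDegree = n := by
    intro t f hf
    have hlt : (C t * X ^ (n - 1)).degree < f.degree := by
      rw [degree_eq_natDegree hf.1.ne_zero, hf.2]
      refine (degree_C_mul_X_pow_le _ _).trans_lt ?_
      norm_cast; omega
    refine ⟨hf.1.add_of_left hlt, ?_⟩
    rw [natDegree_add_eq_left_of_degree_lt hlt, hf.2]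
  have hL : ∀ f : F[X], f.Monic ∧ f.natDegree = n →
      Lam ψ a (f + C (-t) * X ^ (n - 1)) = ψ t * Lam ψ a f := by
    intro f hf
    have h0 : (f + C (-t) * X ^ (n - 1)).coeff 0 = f.coeff 0 := by
      rw [coeff_add, coeff_C_mul_X_pow, if_neg (by omega), add_zero]
    have h1 : (f + C (-t) * X ^ (n - 1)).coeff 1 = f.coeff 1 := by
      rw [coeff_add, coeff_C_mul_X_pow, if_neg (by omega), add_zero]
    have h2 : (f + C (-t) * X ^ (n - 1)).nextCoeff = f.nextCoeff - t := by
      rw [nextCoeff_of_natDegree_pos (by rw [(hdeg _ f hf).2]; omega), (hdeg _ f hf).2,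
        nextCoeff_of_natDegree_pos (by omega), hf.2, coeff_add, coeff_C_mul_X_pow, if_pos rfl]
      ring
    unfold Lam
    rw [h0, h1, h2]
    split_ifs
    · simp
    · rw [← AddChar.map_add_eq_mul]; congr 1; ring
  have key : SS ψ a n = ψ t * SS ψ a n := by
    conv_lhs => rw [SS]
    rw [SS, Finset.mul_sum]
    symm
    refine Finset.sum_bij' (fun f _ => f + C (-t) * X ^ (n - 1))
      (fun f _ => f + C t * X ^ (n - 1)) ?_ ?_ ?_ ?_ ?_
    · intro f hf; exact mem_Mon.2 (hdeg _ f (mem_Mon.1 hf))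
    · intro f hf; exact mem_Mon.2 (hdeg _ f (mem_Mon.1 hf))
    · intro f _; simp
    · intro f _; simp
    · intro f hf; exact (hL f (mem_Mon.1 hf)).symm
  have : (1 - ψ t) * SS ψ a n = 0 := by linear_combination key
  exact (mul_eq_zero.1 this).resolve_left (sub_ne_zero.2 (Ne.symm ht))

lemma sum_Mon_one (g : F[X] → ℂ) : ∑ f ∈ Mon F 1, g f = ∑ c : F, g (X + C c) := by
  symm
  refine Finset.sum_bij (fun c _ => X + C c) ?_ ?_ ?_ ?_
  · intro c _; exact mem_Mon.2 ⟨monic_X_add_C c, natDegree_X_add_C c⟩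
  · intro c _ c' _ h; simpa using h
  · intro f hf
    rw [mem_Mon] at hf
    refine ⟨f.coeff 0, Finset.mem_univ _, ?_⟩
    exact (hf.1.eq_X_add_C hf.2).symm
  · intro c _; rfl

open Classical in
lemma SS_one (ψ : AddChar F ℂ) (a : F) :
    SS ψ a 1 = ∑ c : F, if c = 0 then 0 else ψ (c + a / c) := by
  rw [SS, sum_Mon_one, ← Equiv.sum_comp (Equiv.neg F)]
  refine Finset.sum_congr rfl fun c _ => ?_
  have h : (X + C (-c) : F[X]).nextCoeff = -c := nextCoeff_X_add_C _
  rw [Equiv.neg_apply, Lam, h]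
  simp only [coeff_add, coeff_X_zero, coeff_C_zero, zero_add, neg_eq_zero, coeff_X_one]
  split_ifs with hc
  · rfl
  · congr 1
    rw [coeff_C_of_ne_zero one_ne_zero]
    field_simp
    ring

lemma SS_two (ψ : AddChar F ℂ) (hψ : ψ.IsPrimitive) (a : F) (ha : a ≠ 0) :
    SS ψ a 2 = Fintype.card F := by
  classical
  have hn : ∀ b c : F, (X ^ 2 + C b * X + C c).natDegree = 2 := by
    intro b c
    have := natDegree_quadratic (a := (1 : F)) (b := b) (c := c) one_ne_zero
    simpa using this
  have hm : ∀ b c : F, (X ^ 2 + C b * X + C c).Monic := by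
    intro b c
    rw [Monic, leadingCoeff, hn]; simp [coeff_X, coeff_C]
  have h1 : SS ψ a 2 = ∑ p : F × F, Lam ψ a (X ^ 2 + C p.1 * X + C p.2) := by
    rw [SS]
    symm
    refine Finset.sum_bij (fun p _ => X ^ 2 + C p.1 * X + C p.2) ?_ ?_ ?_ ?_
    · intro p _; exact mem_Mon.2 ⟨hm _ _, hn _ _⟩
    · intro p _ r _ h
      have e0 := congrArg (fun f => coeff f 0) h
      have e1 := congrArg (fun f => coeff f 1) h
      simp [coeff_X, coeff_C] at e0 e1
      exact Prod.ext e1 e0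
    · intro f hf
      rw [mem_Mon] at hf
      refine ⟨(f.coeff 1, f.coeff 0), Finset.mem_univ _, ?_⟩
      conv_rhs => rw [f.as_sum_range, hf.2]
      have : f.coeff 2 = 1 := by have := hf.1.coeff_natDegree; rwa [hf.2] at this
      simp [Finset.sum_range_succ, this, ← C_mul_X_pow_eq_monomial]
      ring
    · intro p _; rfl
  rw [h1, Fintype.sum_prod_type_right]
  have h2 : ∀ c b : F, Lam ψ a (X ^ 2 + C b * X + C c) =
      if c = 0 then 0 else ψ (b * (-(1 + a / c))) := by
    intro c b
    have e : (X ^ 2 + C b * X + C c).nextCoeff = b := by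
      rw [nextCoeff_of_natDegree_pos (by rw [hn]; omega), hn]; simp [coeff_X, coeff_C]
    rw [Lam, e]
    simp [coeff_X, coeff_C]
    split_ifs
    · rfl
    · congr 1; ring
  simp only [h2]
  have h3 : ∀ c : F, (∑ b : F, if c = 0 then (0 : ℂ) else ψ (b * (-(1 + a / c)))) =
      if c = -a then (Fintype.card F : ℂ) else 0 := by
    intro c
    by_cases hc : c = 0
    · subst hc
      have : (0 : F) ≠ -a := by intro h; exact ha (by simpa using h.symm)
      simp [this]
    · simp only [if_neg hc]
      rw [AddChar.sum_mulShift _ hψ]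
      have : -(1 + a / c) = 0 ↔ c = -a := by
        rw [neg_eq_zero]
        constructor
        · intro h; field_simp at h; linear_combination h
        · rintro rfl; field_simp; ring
      simp only [this]
      split_ifs <;> simp
  simp only [h3]
  simp

end lfun
end Klo

namespace Klo
section ext
open Polynomial IntermediateField
variable {F : Type*} [Field F] [Fintype F] {L : Type*} [Field L] [Fintype L] [Algebra F L]

lemma adjoin_inv_eq (x : L) : F⟮x⁻¹⟯ = F⟮x⟯ := by
  apply le_antisymm
  · rw [adjoin_simple_le_iff]; exact inv_mem (mem_adjoin_simple_self F x)
  · rw [adjoin_simple_le_iff]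
    have := inv_mem (mem_adjoin_simple_self F x⁻¹)
    rwa [inv_inv] at this

lemma natDegree_minpoly_inv (x : L) :
    (minpoly F x⁻¹).natDegree = (minpoly F x).natDegree := by
  rw [← adjoin.finrank (.of_finite F x), ← adjoin.finrank (.of_finite F x⁻¹), adjoin_inv_eq]

lemma minpoly_inv (x : L) (hx : x ≠ 0) :
    minpoly F x⁻¹ = (minpoly F x).reverse * C ((minpoly F x).coeff 0)⁻¹ := by
  set P := minpoly F x with hP
  have hint : IsIntegral F x := .of_finite F x
  have hm : P.Monic := minpoly.monic hint
  have h0 : P.coeff 0 ≠ 0 := minpoly.coeff_zero_ne_zero hint hx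
  have htr : P.natTrailingDegree = 0 := by
    rw [natTrailingDegree_eq_zero]; right; exact h0
  have hdeg : P.reverse.natDegree = P.natDegree := by rw [reverse_natDegree, htr, Nat.sub_zero]
  have hlead : P.reverse.leadingCoeff = P.coeff 0 := by
    rw [reverse_leadingCoeff, trailingCoeff, htr]
  symm
  have hR : (P.reverse * C (P.coeff 0)⁻¹).Monic := by
    rw [Monic, leadingCoeff_mul, hlead, leadingCoeff_C, mul_inv_cancel₀ h0]
  have hz : aeval x⁻¹ (P.reverse * C (P.coeff 0)⁻¹) = 0 := by
    rw [map_mul]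
    have : aeval x⁻¹ P.reverse = 0 := by
      letI : Invertible x := invertibleOfNonzero hx
      rw [aeval_def, ← invOf_eq_inv, eval₂_reverse_eq_zero_iff]
      exact minpoly.aeval F x
    rw [this, zero_mul]
  refine eq_of_monic_of_dvd_of_natDegree_le (minpoly.monic (.of_finite F x⁻¹)) hR
    (minpoly.dvd F _ hz) ?_
  rw [natDegree_minpoly_inv, ← hP, ← hdeg]
  exact natDegree_mul_C_le _ _

lemma nextCoeff_minpoly_inv (x : L) (hx : x ≠ 0) :
    (minpoly F x⁻¹).nextCoeff = (minpoly F x).coeff 1 / (minpoly F x).coeff 0 := by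
  have hint : IsIntegral F x := .of_finite F x
  have hpos := minpoly.natDegree_pos hint
  rw [nextCoeff_of_natDegree_pos (by rw [natDegree_minpoly_inv]; exact hpos),
    natDegree_minpoly_inv, minpoly_inv x hx, coeff_mul_C, coeff_reverse,
    revAt_le (Nat.sub_le _ _), Nat.sub_sub_self hpos, div_eq_mul_inv]

lemma finrank_adj (x : L) :
    Module.finrank F⟮x⟯ L = Module.finrank F L / (minpoly F x).natDegree := by
  have hint : IsIntegral F x := .of_finite F x
  rw [← Module.finrank_mul_finrank F F⟮x⟯ L, adjoin.finrank hint,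
    Nat.mul_div_cancel_left _ (minpoly.natDegree_pos hint)]

lemma trace_val (ψ : AddChar F ℂ) (a : F) (x : L) (hx : x ≠ 0) :
    ψ (Algebra.trace F L (x + algebraMap F L a * x⁻¹)) =
      Lam ψ a (minpoly F x) ^ (Module.finrank F L / (minpoly F x).natDegree) := by
  have hint : IsIntegral F x := .of_finite F x
  have h0 : (minpoly F x).coeff 0 ≠ 0 := minpoly.coeff_zero_ne_zero hint hx
  rw [Lam, if_neg h0, ← AddChar.map_nsmul_eq_pow, map_add, ← Algebra.smul_def, map_smul,
    trace_eq_finrank_mul_minpoly_nextCoeff, trace_eq_finrank_mul_minpoly_nextCoeff,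
    nextCoeff_minpoly_inv x hx, finrank_adj, finrank_adj, natDegree_minpoly_inv]
  congr 1
  rw [nsmul_eq_mul, smul_eq_mul]
  ring

open Classical in
lemma card_minpoly {j d : ℕ} (hj : Module.finrank F L = j) (hdj : d ∣ j) {P : F[X]}
    (hP : P ∈ Irr F d) :
    (Finset.univ.filter (fun x : L => minpoly F x = P)).card = d := by
  rw [mem_Irr] at hP
  obtain ⟨⟨hm, hd⟩, hi⟩ := hP
  have hdv := (hi.natDegree_dvd_iff_dvd_X_pow_card_pow_sub_X (n := j)).1 (hd ▸ hdj)
  have hcard : Nat.card F ^ j = Fintype.card L := by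
    rw [← hj, ← Module.natCard_eq_pow_finrank, Nat.card_eq_fintype_card]
  rw [hcard] at hdv
  have hsp : (P.map (algebraMap F L)).Splits := by
    have := FiniteField.isSplittingField_sub L F
    refine Splits.of_dvd (IsSplittingField.splits L (X ^ Fintype.card L - X : F[X])) ?_
      (map_dvd (algebraMap F L) hdv)
    exact (Polynomial.map_ne_zero_iff (algebraMap F L).injective).2
      (FiniteField.X_pow_card_sub_X_ne_zero F Fintype.one_lt_card)
  have hsep : P.Separable := PerfectField.separable_of_irreducible hi
  have := card_rootSet_eq_natDegree (K := L) hsep hsp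
  rw [hd] at this
  rw [← this, ← Set.toFinset_card]
  congr 1
  ext x
  simp only [Finset.mem_filter, Finset.mem_univ, true_and, Set.mem_toFinset,
    mem_rootSet_of_ne hm.ne_zero]
  constructor
  · rintro rfl; exact minpoly.aeval F x
  · intro h; exact (minpoly.eq_of_irreducible_of_monic hi h hm).symm

open Classical in
theorem KK_eq (ψ : AddChar F ℂ) (a : F) {j : ℕ} (hj : Module.finrank F L = j) :
    KK ψ a j = ∑ x : L, if x = 0 then 0 else
      ψ (Algebra.trace F L (x + algebraMap F L a * x⁻¹)) := by
  have hjpos : 0 < j := hj ▸ Module.finrank_pos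
  have hval : ∀ x : L, (if x = 0 then 0 else
      ψ (Algebra.trace F L (x + algebraMap F L a * x⁻¹))) =
      Lam ψ a (minpoly F x) ^ (j / (minpoly F x).natDegree) := by
    intro x
    split_ifs with hx
    · subst hx
      rw [minpoly.zero, Lam, if_pos (by simp), natDegree_X, Nat.div_one, zero_pow hjpos.ne']
    · rw [trace_val ψ a x hx, hj]
  simp only [hval]
  have hdvd : ∀ x : L, (minpoly F x).natDegree ∣ j := fun x => hj ▸ minpoly.degree_dvd (.of_finite F x)
  rw [KK, Finset.sum_sigma']
  rw [← Finset.sum_fiberwise_of_maps_to (s := (Finset.univ : Finset L))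
    (t := j.divisorsAntidiagonal.sigma (fun y => Irr F y.1))
    (g := fun x => ⟨((minpoly F x).natDegree, j / (minpoly F x).natDegree), minpoly F x⟩)]
  · refine Finset.sum_congr rfl ?_
    rintro ⟨⟨d, m⟩, P⟩ h
    simp only [Finset.mem_sigma, Nat.mem_divisorsAntidiagonal] at h
    obtain ⟨⟨h1, h2⟩, hP⟩ := h
    have hP' := hP
    rw [mem_Irr] at hP'
    have hdpos : 0 < d := by rw [← hP'.1.2]; exact hP'.2.natDegree_pos
    have hm : j / d = m := by rw [← h1, Nat.mul_div_cancel_left _ hdpos]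
    have hf : (Finset.univ.filter (fun x : L =>
        (⟨((minpoly F x).natDegree, j / (minpoly F x).natDegree), minpoly F x⟩ :
          (_ : ℕ × ℕ) × F[X]) = ⟨(d, m), P⟩)) =
        Finset.univ.filter (fun x : L => minpoly F x = P) := by
      ext x
      simp only [Finset.mem_filter, Finset.mem_univ, true_and, Sigma.mk.injEq, heq_eq_eq,
        Prod.mk.injEq]
      constructor
      · exact fun h => h.2
      · rintro rfl; rw [hP'.1.2]; exact ⟨⟨rfl, hm⟩, rfl⟩
    rw [hf, Finset.sum_congr rfl (g := fun _ => Lam ψ a P ^ m)]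
    · rw [Finset.sum_const, card_minpoly hj ⟨m, h1.symm⟩ hP, nsmul_eq_mul]
    · intro x hx
      rw [(Finset.mem_filter.1 hx).2, hP'.1.2, hm]
  · intro x _
    simp only [Finset.mem_sigma, Nat.mem_divisorsAntidiagonal, mem_Irr]
    exact ⟨⟨Nat.mul_div_cancel' (hdvd x), hjpos.ne'⟩, ⟨minpoly.monic (.of_finite F x), trivial⟩,
      minpoly.irreducible (.of_finite F x)⟩

end ext
end Klo

namespace Klo
section bnd
open Polynomial
variable {F : Type*} [Field F] [Fintype F] {L : Type*} [Field L] [Fintype L] [Algebra F L]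

lemma trace_surj : Function.Surjective (Algebra.trace F L) := by
  exact Algebra.trace_surjective F L

lemma hilbert90 (z : L) (hz : Algebra.trace F L z = 0) :
    ∃ y : L, y ^ Fintype.card F - y = z := by
  classical
  let T : L →ₗ[F] L := (FiniteField.frobeniusAlgHom F L).toLinearMap - LinearMap.id
  have hT : ∀ y, T y = y ^ Fintype.card F - y := fun y => rfl
  have hle : LinearMap.range T ≤ LinearMap.ker (Algebra.trace F L) := by
    rintro _ ⟨y, rfl⟩
    rw [LinearMap.mem_ker, hT, map_sub, sub_eq_zero]
    exact (Algebra.trace_eq_of_algEquiv (FiniteField.frobeniusAlgEquivOfAlgebraic F L) y)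
  have hq1 : 1 < Fintype.card F := Fintype.one_lt_card
  have hker : Module.finrank F (LinearMap.ker T) ≤ 1 := by
    have h1 : Nat.card (LinearMap.ker T) ≤ Fintype.card F := by
      have hne := FiniteField.X_pow_card_sub_X_ne_zero L hq1
      have hs : ((LinearMap.ker T : Submodule F L) : Set L) ⊆
          ((X ^ Fintype.card F - X : L[X]).roots.toFinset : Set L) := by
        intro y hy
        have hy' : T y = 0 := hy
        rw [hT] at hy'
        simp only [Finset.mem_coe, Multiset.mem_toFinset]
        rw [mem_roots hne]
        simpa using hy'
      have h2 : Nat.card (LinearMap.ker T) ≤ (X ^ Fintype.card F - X : L[X]).roots.toFinset.card := by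
        have := Set.ncard_le_ncard hs (Finset.finite_toSet _)
        rwa [Set.ncard_coe_finset] at this
      refine h2.trans ((Multiset.toFinset_card_le _).trans ((card_roots' _).trans ?_))
      rw [FiniteField.X_pow_card_sub_X_natDegree_eq L hq1]
    rw [Module.natCard_eq_pow_finrank (K := F), Nat.card_eq_fintype_card] at h1
    by_contra! h
    have : Fintype.card F ^ 1 < Fintype.card F ^ Module.finrank F (LinearMap.ker T) :=
      Nat.pow_lt_pow_right hq1 h
    rw [pow_one] at this
    omega
  have hr1 := LinearMap.finrank_range_add_finrank_ker T
  have hr2 := LinearMap.finrank_range_add_finrank_ker (Algebra.trace F L)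
  have hr3 : Module.finrank F (LinearMap.range (Algebra.trace F L)) = 1 := by
    rw [LinearMap.range_eq_top.2 trace_surj, finrank_top, Module.finrank_self]
  have heq : LinearMap.range T = LinearMap.ker (Algebra.trace F L) :=
    Submodule.eq_of_le_of_finrank_le hle (by omega)
  have : z ∈ LinearMap.range T := by rw [heq]; exact hz
  obtain ⟨y, hy⟩ := this
  exact ⟨y, hy⟩

open Classical in
lemma fiber_bound {q m : ℕ} (hq : Fintype.card F = q) (h2 : (2 : F) ≠ 0) (hm : 1 ≤ m)
    (hL : Module.finrank F L = 2 * m) (a : F) (ha : a ≠ 0) (c : F) :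
    q * (Finset.univ.filter (fun x : L => x ≠ 0 ∧
      Algebra.trace F L (x + algebraMap F L a * x⁻¹) = c)).card ≤ q ^ (2 * m) + 8 * q * q ^ m := by
  obtain ⟨δ, hδ⟩ := trace_surj (F := F) (L := L) c
  have hq3 : 3 ≤ q := by
    have h1 : 1 < q := hq ▸ Fintype.one_lt_card
    rcases Nat.lt_or_ge 2 q with h | h
    · exact h
    · exfalso
      have : q = 2 := by omega
      have h3 := FiniteField.cast_card_eq_zero F
      rw [hq, this] at h3
      exact h2 (by exact_mod_cast h3)
  have h2L : (2 : L) ≠ 0 := by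
    intro h
    apply h2
    apply (algebraMap F L).injective
    rw [map_ofNat, map_zero, h]
  have hqs : q * q ^ (m - 1) = q ^ m := by rw [← pow_succ']; congr 1; omega
  have hcard : Fintype.card L = (q * q ^ (m - 1)) * (q * q ^ (m - 1)) := by
    rw [hqs, ← pow_add, ← two_mul, ← hL, ← hq, Module.card_eq_pow_finrank (K := F)]
  let w : L[X] := X ^ q - X + C δ
  have hw : w.degree = q := by
    have h1 : (X ^ q : L[X]).degree = q := degree_X_pow q
    have h3 : (-X + C δ : L[X]).degree < (X ^ q : L[X]).degree := by
      rw [h1]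
      refine (degree_add_le _ _).trans_lt (max_lt ?_ ?_)
      · rw [degree_neg, degree_X]; exact_mod_cast (by omega : 1 < q)
      · exact degree_C_le.trans_lt (by exact_mod_cast (by omega : 0 < q))
    have : w = X ^ q + (-X + C δ) := by simp only [w]; ring
    rw [this, degree_add_eq_left_of_degree_lt h3, h1]
  let φ : L →+* L := ((FiniteField.frobeniusAlgHom F L) ^ m : L →ₐ[F] L).toRingHom
  have hφ : ∀ x, φ x = x ^ (q * q ^ (m - 1)) := by
    intro x
    change ((FiniteField.frobeniusAlgHom F L) ^ m : L →ₐ[F] L) x = _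
    rw [AlgHom.coe_pow, FiniteField.coe_frobeniusAlgHom, pow_iterate, hqs, hq]
  have hB := bombieri h2L q (q ^ (m - 1)) hq3 (Nat.one_le_pow _ _ (by omega)) (algebraMap F L a)
    ((_root_.map_ne_zero _).2 ha) w hw φ hφ hcard
  rw [hqs, ← pow_add, ← two_mul] at hB
  refine le_trans ?_ hB
  have hy : ∀ x : L, ∃ y : L, (x ≠ 0 ∧ Algebra.trace F L (x + algebraMap F L a * x⁻¹) = c) →
      y ^ q - y = x + algebraMap F L a * x⁻¹ - δ := by
    intro x
    by_cases h : x ≠ 0 ∧ Algebra.trace F L (x + algebraMap F L a * x⁻¹) = c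
    · obtain ⟨y, hy⟩ := hilbert90 (F := F) (x + algebraMap F L a * x⁻¹ - δ)
        (by rw [map_sub, h.2, hδ, sub_self])
      exact ⟨y, fun _ => hq ▸ hy⟩
    · exact ⟨0, fun h' => absurd h' h⟩
  choose y hy using hy
  rw [← hq, ← Finset.card_univ, ← Finset.card_product]
  refine Finset.card_le_card_of_injOn (fun p => (p.2, y p.2 + algebraMap F L p.1)) ?_ ?_
  · rintro ⟨t, x⟩ h
    have hx : x ≠ 0 ∧ Algebra.trace F L (x + algebraMap F L a * x⁻¹) = c := by
      simpa using h
    have h1 := hy x hx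
    have ht : (algebraMap F L t) ^ q = algebraMap F L t := by
      rw [← map_pow, ← hq, FiniteField.pow_card]
    have hadd : (y x + algebraMap F L t) ^ q = y x ^ q + algebraMap F L t ^ q := by
      have := map_add (FiniteField.frobeniusAlgHom F L) (y x) (algebraMap F L t)
      simpa only [FiniteField.coe_frobeniusAlgHom, hq] using this
    simp only [Finset.coe_filter, Finset.mem_univ, true_and, Set.mem_ofPred_eq]
    have : w.eval (y x + algebraMap F L t) = x + algebraMap F L a * x⁻¹ := by
      simp only [w, eval_add, eval_sub, eval_pow, eval_X, eval_C]
      rw [hadd, ht]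
      linear_combination h1
    rw [this]
    have := mul_inv_cancel₀ hx.1
    linear_combination (-algebraMap F L a) * this
  · rintro ⟨t, x⟩ _ ⟨t', x'⟩ _ h
    simp only [Prod.mk.injEq] at h
    obtain ⟨rfl, h⟩ := h
    have := (algebraMap F L).injective (add_left_cancel h)
    rw [this]

open Classical in
lemma KK_bound_aux {q m : ℕ} (hq : Fintype.card F = q) (h2 : (2 : F) ≠ 0) (hm : 1 ≤ m)
    (hL : Module.finrank F L = 2 * m) (ψ : AddChar F ℂ) (hψ : ψ ≠ 1) (a : F) (ha : a ≠ 0) :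
    ‖KK ψ a (2 * m)‖ ≤ 9 * q * (q : ℝ) ^ m := by
  set N : F → ℕ := fun c => (Finset.univ.filter (fun x : L => x ≠ 0 ∧
      Algebra.trace F L (x + algebraMap F L a * x⁻¹) = c)).card with hN
  have hNb : ∀ c, q * N c ≤ q ^ (2 * m) + 8 * q * q ^ m := fun c =>
    fiber_bound hq h2 hm hL a ha c
  have hq0 : 0 < (q : ℝ) := by
    have : 0 < q := hq ▸ Fintype.card_pos
    exact_mod_cast this
  have hq1 : 1 ≤ (q : ℝ) := by
    have : 0 < q := hq ▸ Fintype.card_pos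
    exact_mod_cast this
  have hsum : ∑ c, N c = q ^ (2 * m) - 1 := by
    have h1 : ∑ c, N c = (Finset.univ.filter (fun x : L => x ≠ 0)).card := by
      rw [Finset.card_eq_sum_card_fiberwise (f := fun x : L =>
        Algebra.trace F L (x + algebraMap F L a * x⁻¹)) (t := Finset.univ)
        (fun _ _ => Finset.mem_coe.2 (Finset.mem_univ _))]
      refine Finset.sum_congr rfl fun c _ => ?_
      rw [hN, Finset.filter_filter]
    rw [h1, Finset.filter_ne', Finset.card_erase_of_mem (Finset.mem_univ _), Finset.card_univ,
      Module.card_eq_pow_finrank (K := F), hL, hq]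
  have hK : KK ψ a (2 * m) = ∑ c, (N c : ℂ) * ψ c := by
    rw [KK_eq ψ a hL]
    have h1 : (∑ x : L, if x = 0 then 0 else
      ψ (Algebra.trace F L (x + algebraMap F L a * x⁻¹))) =
      ∑ x ∈ Finset.univ.filter (fun x : L => x ≠ 0),
        ψ (Algebra.trace F L (x + algebraMap F L a * x⁻¹)) := by
      rw [Finset.sum_filter]
      exact Finset.sum_congr rfl fun x _ => by by_cases h : x = 0 <;> simp [h]
    rw [h1, ← Finset.sum_fiberwise _ (fun x : L =>
        Algebra.trace F L (x + algebraMap F L a * x⁻¹))]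
    refine Finset.sum_congr rfl fun c _ => ?_
    rw [hN, Finset.filter_filter, Finset.sum_congr rfl (g := fun _ => ψ c)]
    · rw [Finset.sum_const, nsmul_eq_mul]
    · intro x hx; rw [(Finset.mem_filter.1 hx).2.2]
  set B : ℝ := ((q : ℝ) ^ (2 * m) + 8 * q * q ^ m) / q with hB
  have hNB : ∀ c, (N c : ℝ) ≤ B := by
    intro c
    rw [hB, le_div_iff₀ hq0]
    have := hNb c
    have h3 : (q : ℝ) * N c ≤ q ^ (2 * m) + 8 * q * q ^ m := by exact_mod_cast this
    linarith
  have hK2 : KK ψ a (2 * m) = ∑ c, ((N c : ℂ) - (B : ℂ)) * ψ c := by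
    have h0 : ∑ c, ψ c = 0 := by
      have := AddChar.sum_eq_zero_iff_ne_zero (ψ := ψ)
      rw [this]; exact hψ
    simp only [sub_mul, Finset.sum_sub_distrib, ← Finset.mul_sum, h0, mul_zero, sub_zero, hK]
  rw [hK2]
  have hn : ∀ c, ‖((N c : ℂ) - (B : ℂ)) * ψ c‖ = B - N c := by
    intro c
    rw [norm_mul, AddChar.norm_apply, mul_one]
    have : ((N c : ℂ) - (B : ℂ)) = (((N c : ℝ) - B : ℝ) : ℂ) := by push_cast; rfl
    rw [this, Complex.norm_real, Real.norm_eq_abs, abs_of_nonpos (by linarith [hNB c])]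
    ring
  refine (norm_sum_le _ _).trans ?_
  simp only [hn, Finset.sum_sub_distrib, Finset.sum_const, Finset.card_univ, hq, nsmul_eq_mul]
  have hs : (∑ c, (N c : ℝ)) = q ^ (2 * m) - 1 := by
    rw [← Nat.cast_sum, hsum, Nat.cast_sub (Nat.one_le_pow _ _ (hq ▸ Fintype.card_pos))]
    push_cast; rfl
  rw [hs, hB, mul_div_cancel₀ _ hq0.ne']
  have : 1 ≤ (q : ℝ) ^ m := one_le_pow₀ hq1
  nlinarith

lemma KK_bound {F : Type} [Field F] [Fintype F] {q m : ℕ} (hq : Fintype.card F = q)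
    (h2 : (2 : F) ≠ 0) (hm : 1 ≤ m) (ψ : AddChar F ℂ) (hψ : ψ ≠ 1) (a : F) (ha : a ≠ 0) :
    ‖KK ψ a (2 * m)‖ ≤ 9 * q * (q : ℝ) ^ m := by
  obtain ⟨p, hp⟩ := CharP.exists F
  have : Fact (Nat.Prime p) := ⟨CharP.char_is_prime F p⟩
  have : NeZero (2 * m) := ⟨by omega⟩
  have : Fintype (FiniteField.Extension F p (2 * m)) := Fintype.ofFinite _
  exact KK_bound_aux (L := FiniteField.Extension F p (2 * m)) hq h2 hm
    (FiniteField.finrank_extension F p (2 * m)) ψ hψ a ha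

end bnd
end Klo

namespace Klo
section weil

/-- Growth argument. -/
lemma growth {r C : ℝ} (hr : 1 < r) (h : ∀ m : ℕ, 1 ≤ m → r ^ m ≤ C) : False := by
  obtain ⟨n, hn⟩ := pow_unbounded_of_one_lt C hr
  have h1 := h (n + 1) (by omega)
  have : r ^ n ≤ r ^ (n + 1) := pow_le_pow_right₀ hr.le (by omega)
  linarith

lemma KK_power (S K : ℕ → ℂ) (hN : ∀ n : ℕ, (n : ℂ) * S n = ∑ j ∈ Finset.Icc 1 n, K j * S (n - j))
    (h0 : S 0 = 1) (h3 : ∀ n, 3 ≤ n → S n = 0) (α β : ℂ) (h1 : S 1 = -(α + β))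
    (h2 : S 2 = α * β) (n : ℕ) : K (n + 1) = -(α ^ (n + 1) + β ^ (n + 1)) := by
  have k1 : K 1 = -(α + β) := by
    have := hN 1
    simp [h0] at this
    rw [← this, h1]
  have k2 : K 2 = -(α ^ 2 + β ^ 2) := by
    have := hN 2
    rw [show Finset.Icc 1 2 = {1, 2} from rfl] at this
    simp [h0, h1, h2, k1] at this
    linear_combination -this
  have hrec : ∀ n, K (n + 3) = (α + β) * K (n + 2) - α * β * K (n + 1) := by
    intro n
    have := hN (n + 3)
    rw [h3 (n + 3) (by omega), mul_zero, Finset.sum_Icc_succ_top (by omega),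
      Finset.sum_Icc_succ_top (by omega), Finset.sum_Icc_succ_top (by omega)] at this
    rw [Finset.sum_eq_zero (s := Finset.Icc 1 n)] at this
    · rw [show n + 3 - (n + 1) = 2 by omega, show n + 3 - (n + 1 + 1) = 1 by omega,
        show n + 3 - (n + 1 + 1 + 1) = 0 by omega, h0, h1, h2] at this
      rw [show n + 1 + 1 + 1 = n + 3 by omega, show n + 1 + 1 = n + 2 by omega] at this
      linear_combination -this
    · intro j hj
      rw [Finset.mem_Icc] at hj
      rw [h3 (n + 3 - j) (by omega), mul_zero]
  have key : ∀ n, K (n + 1) = -(α ^ (n + 1) + β ^ (n + 1)) ∧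
      K (n + 2) = -(α ^ (n + 2) + β ^ (n + 2)) := by
    intro n
    induction n with
    | zero => exact ⟨by simpa using k1, by simpa using k2⟩
    | succ n ih =>
      refine ⟨ih.2, ?_⟩
      rw [show n + 1 + 2 = n + 3 by omega, hrec n, ih.1, ih.2]
      ring
  exact (key n).1

lemma root_bound {q C : ℝ} (hq : 0 < q) (α β : ℂ) (hαβ : α * β = q)
    (h : ∀ m : ℕ, 1 ≤ m → ‖α ^ (2 * m) + β ^ (2 * m)‖ ≤ C * q ^ m) : ‖α‖ ^ 2 ≤ q := by
  by_contra! hc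
  have hn : ‖α‖ * ‖β‖ = q := by
    rw [← norm_mul, hαβ, Complex.norm_real, Real.norm_eq_abs, abs_of_pos hq]
  have hβ : ‖β‖ ^ 2 ≤ q := by
    by_contra! hb
    have : ‖α‖ ^ 2 * ‖β‖ ^ 2 = q * q := by rw [← mul_pow, hn]; ring
    nlinarith
  refine growth (r := ‖α‖ ^ 2 / q) (C := C + 1) ((one_lt_div hq).2 hc) fun m hm => ?_
  rw [div_pow, div_le_iff₀ (pow_pos hq m)]
  have h1 := h m hm
  have h2 : ‖α ^ (2 * m)‖ ≤ ‖α ^ (2 * m) + β ^ (2 * m)‖ + ‖β ^ (2 * m)‖ := by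
    have := norm_sub_le (α ^ (2 * m) + β ^ (2 * m)) (β ^ (2 * m))
    simpa using this
  rw [norm_pow, norm_pow, pow_mul ‖α‖, pow_mul ‖β‖] at h2
  have h3 : (‖β‖ ^ 2) ^ m ≤ q ^ m := pow_le_pow_left₀ (by positivity) hβ m
  linarith

open Classical in
theorem kloosterman {F : Type} [Field F] [Fintype F] (h2 : (2 : F) ≠ 0) (ψ : AddChar F ℂ)
    (hψ : ψ ≠ 1) (a : F) (ha : a ≠ 0) :
    ‖∑ c : F, if c = 0 then 0 else ψ (c + a / c)‖ ≤ 2 * Real.sqrt (Fintype.card F) := by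
  rw [← SS_one]
  set q := Fintype.card F with hq
  have hq0 : (0 : ℝ) < q := by exact_mod_cast (Fintype.card_pos : 0 < Fintype.card F)
  obtain ⟨D, hD⟩ := IsAlgClosed.exists_pow_nat_eq ((SS ψ a 1) ^ 2 - 4 * (q : ℂ)) (n := 2) (by norm_num)
  set α : ℂ := (-SS ψ a 1 + D) / 2 with hα
  set β : ℂ := (-SS ψ a 1 - D) / 2 with hβ
  have hsum : SS ψ a 1 = -(α + β) := by rw [hα, hβ]; ring
  have hprod : α * β = q := by
    rw [hα, hβ]; linear_combination (-1/4) * hD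
  have hK := KK_power (SS ψ a) (KK ψ a) (newton ψ a) (SS_zero ψ a) (SS_ge_three ψ hψ a) α β hsum
    (by rw [hprod, SS_two ψ (AddChar.IsPrimitive.of_ne_one hψ) a ha])
  have hb : ∀ m : ℕ, 1 ≤ m → ‖α ^ (2 * m) + β ^ (2 * m)‖ ≤ (9 * q) * (q : ℝ) ^ m := by
    intro m hm
    have h1 := KK_bound hq.symm h2 hm ψ hψ a ha
    have h3 := hK (2 * m - 1)
    rw [show 2 * m - 1 + 1 = 2 * m by omega] at h3
    rwa [h3, norm_neg] at h1
  have ha1 := root_bound hq0 α β (by exact_mod_cast hprod) hb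
  have hb1 := root_bound hq0 β α (by rw [mul_comm]; exact_mod_cast hprod) (C := 9 * q)
    (fun m hm => by rw [add_comm]; exact hb m hm)
  have ha2 := Real.le_sqrt_of_sq_le ha1
  have hb2 := Real.le_sqrt_of_sq_le hb1
  rw [hsum, norm_neg]
  linarith [norm_add_le α β]

end weil
end Klo

namespace Klo
section gauss
variable {F : Type} [Field F] [Fintype F] [DecidableEq F]

/-- complex valued quadratic character -/
noncomputable def eta (F : Type) [Field F] [Fintype F] [DecidableEq F] : MulChar F ℂ :=
  (quadraticChar F).ringHomComp (Int.castRingHom ℂ)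

lemma eta_apply (x : F) : eta F x = ((quadraticChar F x : ℤ) : ℂ) := rfl

@[simp]
lemma eta_zero : eta F 0 = 0 := by
  rw [eta_apply, quadraticChar_zero, Int.cast_zero]

lemma rc (h2 : (2 : F) ≠ 0) : ringChar F ≠ 2 := by
  intro h
  apply h2
  have := ringChar.Nat.cast_ringChar (R := F)
  rw [h] at this
  exact_mod_cast this

lemma eta_sq (x : F) (hx : x ≠ 0) : eta F x * eta F x = 1 := by
  rw [eta_apply, ← Int.cast_mul, ← sq, quadraticChar_sq_one hx, Int.cast_one]

lemma eta_norm (x : F) (hx : x ≠ 0) : ‖eta F x‖ = 1 := by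
  rw [eta_apply]
  rcases quadraticChar_dichotomy hx with h | h <;> simp [h]

lemma eta_ne_one (h2 : (2 : F) ≠ 0) : eta F ≠ 1 := by
  intro h
  obtain ⟨a, ha⟩ := quadraticChar_exists_neg_one (rc h2)
  have ha0 : a ≠ 0 := by rintro rfl; simp at ha
  have h1 : eta F a = 1 := by rw [h, MulChar.one_apply (IsUnit.mk0 a ha0)]
  rw [eta_apply, ha] at h1
  norm_num at h1

lemma eta_quad : (eta F).IsQuadratic := by
  intro a
  rw [eta_apply]
  rcases quadraticChar_isQuadratic F a with h | h | h <;> simp [h]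

lemma norm_G (h2 : (2 : F) ≠ 0) (ψ : AddChar F ℂ) (hψ : ψ ≠ 1) :
    ‖gaussSum (eta F) ψ‖ = Real.sqrt (Fintype.card F) := by
  have h := congrArg norm (gaussSum_sq (eta_ne_one h2) eta_quad (AddChar.IsPrimitive.of_ne_one hψ))
  rw [norm_pow, norm_mul, eta_norm _ (neg_ne_zero.2 one_ne_zero), one_mul, Complex.norm_natCast] at h
  rw [← h, Real.sqrt_sq (norm_nonneg _)]

lemma sum_eta_shift (ψ : AddChar F ℂ) (t : F) (ht : t ≠ 0) :
    ∑ a, eta F a * ψ (t * a) = eta F t * gaussSum (eta F) ψ := by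
  have h := gaussSum_mulShift (eta F) ψ (Units.mk0 t ht)
  rw [Units.val_mk0] at h
  rw [← h, ← mul_assoc, eta_sq t ht, one_mul]
  rfl

lemma sum_psi_zero (ψ : AddChar F ℂ) (hψ : ψ ≠ 1) (t : F) (ht : t ≠ 0) : ∑ a, ψ (t * a) = 0 := by
  have := AddChar.sum_mulShift t (AddChar.IsPrimitive.of_ne_one hψ)
  rw [if_neg ht] at this
  rw [← Nat.cast_zero, ← this]
  exact Finset.sum_congr rfl fun a _ => by rw [mul_comm]

lemma card_sqrts (h2 : (2 : F) ≠ 0) (a : F) :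
    ((Finset.univ.filter (fun x : F => x ^ 2 = a)).card : ℂ) = eta F a + 1 := by
  have h := quadraticChar_card_sqrts (rc h2) a
  rw [eta_apply]
  have h' : ((Finset.univ.filter (fun x : F => x ^ 2 = a)).card : ℤ) = quadraticChar F a + 1 := by
    rw [← h]; congr 2; ext; simp
  exact_mod_cast congrArg (Int.cast : ℤ → ℂ) h'

lemma sum_sq (h2 : (2 : F) ≠ 0) (f : F → ℂ) :
    ∑ z, f (z ^ 2) = ∑ a, (eta F a + 1) * f a := by
  rw [← Finset.sum_fiberwise _ (fun z : F => z ^ 2)]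
  refine Finset.sum_congr rfl fun a _ => ?_
  rw [← card_sqrts h2, Finset.sum_congr rfl (g := fun _ => f a), Finset.sum_const, nsmul_eq_mul]
  intro x hx; rw [(Finset.mem_filter.1 hx).2]

lemma quad_gauss (h2 : (2 : F) ≠ 0) (ψ : AddChar F ℂ) (hψ : ψ ≠ 1) (t : F) (ht : t ≠ 0) (ξ : F) :
    ∑ z, ψ (t * z ^ 2 - ξ * z) = ψ (-(ξ ^ 2 / 4) / t) * (eta F t * gaussSum (eta F) ψ) := by
  have h4 : (4 : F) ≠ 0 := by
    have : (4 : F) = 2 * 2 := by norm_num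
    rw [this]; exact mul_ne_zero h2 h2
  have h1 : ∀ z, ψ (t * (z + ξ / (2 * t)) ^ 2 - ξ * (z + ξ / (2 * t))) =
      ψ (-(ξ ^ 2 / 4) / t) * ψ (t * z ^ 2) := by
    intro z
    rw [← AddChar.map_add_eq_mul]
    congr 1
    field_simp
    ring
  rw [← Equiv.sum_comp (Equiv.addRight (ξ / (2 * t)))]
  simp only [Equiv.coe_addRight, h1]
  rw [← Finset.mul_sum, sum_sq h2 (fun a => ψ (t * a))]
  simp only [add_mul, one_mul, Finset.sum_add_distrib]
  rw [sum_psi_zero ψ hψ t ht, add_zero, sum_eta_shift ψ t ht]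

lemma sum_add_inv (h2 : (2 : F) ≠ 0) (g : F → ℂ) :
    ∑ u, (if u = 0 then 0 else g (u + 1 / u)) = ∑ v, (eta F (v ^ 2 - 4) + 1) * g v := by
  have e : ∑ u, (if u = 0 then 0 else g (u + 1 / u)) =
      ∑ u ∈ Finset.univ.filter (fun u : F => u ≠ 0), g (u + 1 / u) := by
    rw [Finset.sum_filter]
    exact Finset.sum_congr rfl fun x _ => by by_cases h : x = 0 <;> simp [h]
  rw [e, ← Finset.sum_fiberwise _ (fun u : F => u + 1 / u)]
  refine Finset.sum_congr rfl fun v _ => ?_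
  rw [Finset.filter_filter, ← card_sqrts h2, Finset.sum_congr rfl (g := fun _ => g v),
    Finset.sum_const, nsmul_eq_mul]
  · congr 2
    refine Finset.card_bij' (fun u _ => 2 * u - v) (fun y _ => (y + v) / 2) ?_ ?_ ?_ ?_
    · intro u hu
      simp only [Finset.mem_filter, Finset.mem_univ, true_and] at hu ⊢
      obtain ⟨h0, rfl⟩ := hu
      field_simp
      ring
    · intro y hy
      simp only [Finset.mem_filter, Finset.mem_univ, true_and] at hy ⊢
      have hp : ((y + v) / 2) * ((v - y) / 2) = 1 := by
        field_simp; linear_combination -hy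
      have h0 : (y + v) / 2 ≠ 0 := left_ne_zero_of_mul_eq_one hp
      refine ⟨h0, ?_⟩
      rw [one_div, ← eq_inv_of_mul_eq_one_right hp]
      field_simp
      ring
    · intro u _; field_simp; ring
    · intro y _; field_simp; ring
  · intro x hx; rw [(Finset.mem_filter.1 hx).2.2]

lemma eta_four (h2 : (2 : F) ≠ 0) (x : F) : eta F (4 * x) = eta F x := by
  rw [map_mul, show (4 : F) = 2 * 2 by norm_num, map_mul, eta_sq 2 h2, one_mul]

lemma salie_id (h2 : (2 : F) ≠ 0) (f : F → ℂ) :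
    ∑ u, eta F u * f (u + 1 / u) = ∑ v, (eta F (v + 2) + eta F (v - 2)) * f v := by
  have h := sum_add_inv h2 (fun v => eta F (v + 2) * f v)
  have hl : ∑ u, (if u = 0 then 0 else eta F (u + 1 / u + 2) * f (u + 1 / u)) =
      ∑ u, eta F u * f (u + 1 / u) - eta F (-1) * f (-2) := by
    rw [eq_sub_iff_add_eq]
    have : eta F (-1) * f (-2) = ∑ u : F, if u = -1 then eta F (-1) * f (-2) else 0 := by simp
    rw [this, ← Finset.sum_add_distrib]
    refine Finset.sum_congr rfl fun u _ => ?_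
    by_cases h0 : u = 0
    · subst h0
      rw [if_pos rfl, if_neg (by intro h; exact one_ne_zero (neg_eq_zero.1 h.symm))]
      simp
    by_cases h1 : u = -1
    · subst h1
      have e1 : (-1 + 1 / (-1) + 2 : F) = 0 := by norm_num
      have e2 : (-1 + 1 / (-1) : F) = -2 := by norm_num
      rw [if_neg h0, e1, e2, if_pos rfl]
      simp
    · rw [if_neg h0, if_neg h1, add_zero]
      have hu : u + 1 ≠ 0 := fun h => h1 (by linear_combination h)
      have e1 : u + 1 / u + 2 = u * (((u + 1) / u) * ((u + 1) / u)) := by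
        field_simp; ring
      rw [e1, map_mul, map_mul, eta_sq _ (div_ne_zero hu h0), mul_one]
  have hr : ∑ v, (eta F (v ^ 2 - 4) + 1) * (eta F (v + 2) * f v) =
      ∑ v, (eta F (v + 2) + eta F (v - 2)) * f v - eta F (-1) * f (-2) := by
    rw [eq_sub_iff_add_eq]
    have : eta F (-1) * f (-2) = ∑ u : F, if u = -2 then eta F (-1) * f (-2) else 0 := by simp
    rw [this, ← Finset.sum_add_distrib]
    refine Finset.sum_congr rfl fun v _ => ?_
    by_cases h1 : v = -2
    · subst h1
      rw [if_pos rfl, show (-2 - 2 : F) = 4 * (-1) by norm_num, eta_four h2]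
      simp
    · rw [if_neg h1, add_zero]
      have hu : v + 2 ≠ 0 := fun h => h1 (by linear_combination h)
      have := eta_sq _ hu
      rw [show v ^ 2 - 4 = (v + 2) * (v - 2) by ring, map_mul]
      linear_combination (eta F (v - 2) * f v) * this
  rw [hl, hr] at h
  linear_combination h

lemma salie (h2 : (2 : F) ≠ 0) (ψ : AddChar F ℂ) (hψ : ψ ≠ 1) (b : F) :
    ‖∑ t, eta F t * ψ (t + b / t)‖ ≤ 2 * Real.sqrt (Fintype.card F) := by
  have hs := Real.sqrt_nonneg (Fintype.card F)
  by_cases hb : b = 0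
  · subst hb
    have : ∑ t, eta F t * ψ (t + 0 / t) = gaussSum (eta F) ψ := by simp [gaussSum]
    rw [this, norm_G h2 ψ hψ]
    linarith
  by_cases hsq : IsSquare b
  · obtain ⟨c, rfl⟩ := hsq
    have hc : c ≠ 0 := fun h => hb (by rw [h, zero_mul])
    have h1 : ∑ t, eta F t * ψ (t + c * c / t) =
        eta F c * ∑ u, eta F u * (fun v => ψ (c * v)) (u + 1 / u) := by
      rw [← Equiv.sum_comp (Equiv.mulLeft₀ c hc), Finset.mul_sum]
      refine Finset.sum_congr rfl fun u _ => ?_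
      change eta F (c * u) * ψ (c * u + c * c / (c * u)) = eta F c * (eta F u * ψ (c * (u + 1 / u)))
      have e : c * u + c * c / (c * u) = c * (u + 1 / u) := by
        rw [mul_div_mul_left _ _ hc]; ring
      rw [e, map_mul, mul_assoc]
    have h3 : ∀ s : F, ∑ v, eta F (v + s) * ψ (c * v) =
        ψ (-(c * s)) * (eta F c * gaussSum (eta F) ψ) := by
      intro s
      rw [← Equiv.sum_comp (Equiv.subRight s), ← sum_eta_shift ψ c hc, Finset.mul_sum]
      refine Finset.sum_congr rfl fun v _ => ?_
      simp only [Equiv.subRight_apply, sub_add_cancel]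
      rw [mul_sub, sub_eq_add_neg, AddChar.map_add_eq_mul]
      ring
    have h4 : ∀ s : F, ‖∑ v, eta F (v + s) * ψ (c * v)‖ = Real.sqrt (Fintype.card F) := by
      intro s
      rw [h3, norm_mul, norm_mul, AddChar.norm_apply, eta_norm c hc, norm_G h2 ψ hψ]
      ring
    rw [h1, salie_id h2 (fun v => ψ (c * v)), norm_mul, eta_norm c hc, one_mul]
    simp only [add_mul, Finset.sum_add_distrib]
    refine (norm_add_le _ _).trans ?_
    have h5 := h4 2
    have h6 := h4 (-2)
    simp only [← sub_eq_add_neg] at h6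
    rw [h5, h6]; linarith
  · have hη : eta F b = -1 := by
      rw [eta_apply, quadraticChar_neg_one_iff_not_isSquare.2 hsq]; simp
    have hinv : Function.Involutive (fun t : F => b / t) := by
      intro t
      change b / (b / t) = t
      rw [div_div_cancel₀ hb]
    have key : ∑ t, eta F t * ψ (t + b / t) = -∑ t, eta F t * ψ (t + b / t) := by
      conv_lhs => rw [← Equiv.sum_comp hinv.toPerm]
      rw [← Finset.sum_neg_distrib]
      refine Finset.sum_congr rfl fun t _ => ?_
      change eta F (b / t) * ψ (b / t + b / (b / t)) = _
      rw [div_div_cancel₀ hb, add_comm (b / t)]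
      by_cases ht : t = 0
      · simp [ht]
      · have e : eta F (b / t) = - eta F t := by
          have : b / t = b * t * (t⁻¹ * t⁻¹) := by field_simp
          rw [this, map_mul, map_mul, map_mul, eta_sq _ (inv_ne_zero ht), hη]; ring
        rw [e]; ring
    have : ∑ t, eta F t * ψ (t + b / t) = 0 := by
      have h3 : (2 : ℂ) * ∑ t, eta F t * ψ (t + b / t) = 0 := by linear_combination key
      exact (mul_eq_zero.1 h3).resolve_left two_ne_zero
    rw [this, norm_zero]; linarith

lemma twisted (h2 : (2 : F) ≠ 0) (ψ : AddChar F ℂ) (hψ : ψ ≠ 1) (d : ℕ) (b : F) :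
    ‖∑ t, if t = 0 then 0 else eta F t ^ d * ψ (t + b / t)‖ ≤
      2 * Real.sqrt (Fintype.card F) := by
  have hs : 1 ≤ Real.sqrt (Fintype.card F) := by
    rw [Real.one_le_sqrt]; exact_mod_cast (Fintype.card_pos : 0 < Fintype.card F)
  rcases Nat.even_or_odd' d with ⟨k, rfl | rfl⟩
  · have e : ∑ t, (if t = 0 then 0 else eta F t ^ (2 * k) * ψ (t + b / t)) =
        ∑ t, if t = 0 then 0 else ψ (t + b / t) := by
      refine Finset.sum_congr rfl fun t _ => ?_
      split_ifs with h
      · rfl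
      · rw [pow_mul, sq, eta_sq t h, one_pow, one_mul]
    rw [e]
    by_cases hb : b = 0
    · subst hb
      have e2 : ∑ t, (if t = 0 then 0 else ψ (t + 0 / t)) = -1 := by
        have h0 : ∑ t, ψ t = 0 := by
          have := sum_psi_zero ψ hψ 1 one_ne_zero
          simpa using this
        have : ∑ t, (if t = 0 then 0 else ψ (t + 0 / t)) = ∑ t, (ψ t - if t = 0 then 1 else 0) := by
          refine Finset.sum_congr rfl fun t _ => ?_
          split_ifs with h
          · simp [h]
          · simp
        rw [this, Finset.sum_sub_distrib, h0]; simp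
      rw [e2]; simp; linarith
    · convert kloosterman h2 ψ hψ b hb
  · have e : ∑ t, (if t = 0 then 0 else eta F t ^ (2 * k + 1) * ψ (t + b / t)) =
        ∑ t, eta F t * ψ (t + b / t) := by
      refine Finset.sum_congr rfl fun t _ => ?_
      split_ifs with h
      · simp [h]
      · rw [pow_succ, pow_mul, sq, eta_sq t h, one_pow, one_mul]
    rw [e]
    exact salie h2 ψ hψ b

end gauss
end Klo

namespace Klo
section fourier
variable {F : Type} [Field F] [Fintype F] [DecidableEq F] {d : ℕ}

lemma psi_sum (ψ : AddChar F ℂ) (f : Fin d → F) : ψ (∑ i, f i) = ∏ i, ψ (f i) := by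
  have h : ∀ s : Finset (Fin d), ψ (∑ i ∈ s, f i) = ∏ i ∈ s, ψ (f i) := by
    intro s
    induction s using Finset.induction with
    | empty => simp
    | insert a s ha ih =>
      rw [Finset.sum_insert ha, Finset.prod_insert ha, AddChar.map_add_eq_mul, ih]
  exact h _

lemma sum_prod_pi (f : Fin d → F → ℂ) : ∑ z : Fin d → F, ∏ i, f i (z i) = ∏ i, ∑ s, f i s := by
  rw [Finset.prod_univ_sum, Fintype.piFinset_univ]

lemma ortho (ψ : AddChar F ℂ) (hψ : ψ ≠ 1) (x : Fin d → F) :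
    ∑ ξ : Fin d → F, ψ (∑ i, ξ i * x i) = if x = 0 then (Fintype.card F : ℂ) ^ d else 0 := by
  have h1 : ∑ ξ : Fin d → F, ψ (∑ i, ξ i * x i) = ∏ i, ∑ s, ψ (s * x i) := by
    rw [← sum_prod_pi (fun i s => ψ (s * x i))]
    exact Finset.sum_congr rfl fun ξ _ => psi_sum _ _
  rw [h1]
  simp only [AddChar.sum_mulShift _ (AddChar.IsPrimitive.of_ne_one hψ)]
  split_ifs with h
  · simp [h]
  · obtain ⟨i, hi⟩ := Function.ne_iff.1 h
    refine Finset.prod_eq_zero (Finset.mem_univ i) ?_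
    have : x i ≠ 0 := hi
    simp [this]

/-- balanced indicator of the unit sphere -/
noncomputable def kk (z : Fin d → F) : ℂ :=
  (if ∑ i, z i ^ 2 = 1 then 1 else 0) - 1 / (Fintype.card F : ℂ)

noncomputable def khat (ψ : AddChar F ℂ) (ξ : Fin d → F) : ℂ := ∑ z, kk z * ψ (-∑ i, ξ i * z i)

lemma card_ne : (Fintype.card F : ℂ) ≠ 0 := by
  exact_mod_cast (Fintype.card_pos : 0 < Fintype.card F).ne'

lemma kk_eq (ψ : AddChar F ℂ) (hψ : ψ ≠ 1) (z : Fin d → F) :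
    (Fintype.card F : ℂ) * kk z = ∑ t, if t = 0 then 0 else ψ (t * (∑ i, z i ^ 2 - 1)) := by
  have h0 : ∑ t, ψ (t * (∑ i, z i ^ 2 - 1)) =
      1 + ∑ t, if t = 0 then 0 else ψ (t * (∑ i, z i ^ 2 - 1)) := by
    have : (1 : ℂ) = ∑ t : F, if t = 0 then 1 else 0 := by simp
    rw [this, ← Finset.sum_add_distrib]
    refine Finset.sum_congr rfl fun t _ => ?_
    split_ifs with h
    · simp [h]
    · simp
  rw [AddChar.sum_mulShift _ (AddChar.IsPrimitive.of_ne_one hψ)] at h0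
  rw [kk, mul_sub, mul_one_div_cancel card_ne, ← sub_eq_iff_eq_add'.2 h0]
  congr 1
  by_cases h : ∑ i, z i ^ 2 = 1
  · simp [h]
  · simp [h, sub_ne_zero.2 h]

lemma khat_eq (h2 : (2 : F) ≠ 0) (ψ : AddChar F ℂ) (hψ : ψ ≠ 1) (ξ : Fin d → F) :
    (Fintype.card F : ℂ) * khat ψ ξ = gaussSum (eta F) ψ ^ d *
      ∑ t, if t = 0 then 0 else eta F t ^ d * ψ⁻¹ (t + (∑ i, ξ i ^ 2 / 4) / t) := by
  rw [khat, Finset.mul_sum, Finset.mul_sum]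
  have h1 : ∀ z : Fin d → F, (Fintype.card F : ℂ) * (kk z * ψ (-∑ i, ξ i * z i)) =
      ∑ t, if t = 0 then 0 else ψ (-t) * ∏ i, ψ (t * z i ^ 2 - ξ i * z i) := by
    intro z
    rw [← mul_assoc, kk_eq ψ hψ, Finset.sum_mul]
    refine Finset.sum_congr rfl fun t _ => ?_
    split_ifs with h
    · simp
    · rw [← psi_sum, ← AddChar.map_add_eq_mul, ← AddChar.map_add_eq_mul]
      congr 1
      rw [Finset.sum_sub_distrib, ← Finset.mul_sum]
      ring
  simp only [h1]
  rw [Finset.sum_comm]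
  refine Finset.sum_congr rfl fun t _ => ?_
  split_ifs with ht
  · simp
  · rw [← Finset.mul_sum, sum_prod_pi (fun i s => ψ (t * s ^ 2 - ξ i * s))]
    simp only [quad_gauss h2 ψ hψ t ht]
    rw [Finset.prod_mul_distrib, Finset.prod_const, Finset.card_univ, Fintype.card_fin, ← psi_sum,
      AddChar.inv_apply, mul_pow]
    have : ψ (-(t + (∑ i, ξ i ^ 2 / 4) / t)) = ψ (-t) * ψ (∑ i, -(ξ i ^ 2 / 4) / t) := by
      have hs : ∑ i, -(ξ i ^ 2 / 4) / t = -((∑ i, ξ i ^ 2 / 4) / t) := by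
        rw [Finset.sum_div, ← Finset.sum_neg_distrib]
        exact Finset.sum_congr rfl fun i _ => by ring
      rw [← AddChar.map_add_eq_mul, hs]
      congr 1; ring
    rw [this]; ring

lemma khat_bound (h2 : (2 : F) ≠ 0) (ψ : AddChar F ℂ) (hψ : ψ ≠ 1) (ξ : Fin d → F) :
    (Fintype.card F : ℝ) * ‖khat ψ ξ‖ ≤ 2 * Real.sqrt (Fintype.card F) ^ (d + 1) := by
  have h := congrArg norm (khat_eq h2 ψ hψ ξ)
  rw [norm_mul, norm_mul, norm_pow, norm_G h2 ψ hψ, Complex.norm_natCast] at h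
  rw [h, pow_succ]
  have := twisted h2 ψ⁻¹ (inv_ne_one.2 hψ) d (∑ i, ξ i ^ 2 / 4)
  have hs := pow_nonneg (Real.sqrt_nonneg (Fintype.card F)) d
  nlinarith

lemma kk_inv (ψ : AddChar F ℂ) (hψ : ψ ≠ 1) (z : Fin d → F) :
    (Fintype.card F : ℂ) ^ d * kk z = ∑ ξ, khat ψ ξ * ψ (∑ i, ξ i * z i) := by
  simp only [khat, Finset.sum_mul]
  rw [Finset.sum_comm]
  have h1 : ∀ y : Fin d → F, ∑ ξ : Fin d → F, kk y * ψ (-∑ i, ξ i * y i) * ψ (∑ i, ξ i * z i) =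
      if y = z then (Fintype.card F : ℂ) ^ d * kk z else 0 := by
    intro y
    have h := ortho ψ hψ (z - y)
    have e : ∀ ξ : Fin d → F, kk y * ψ (-∑ i, ξ i * y i) * ψ (∑ i, ξ i * z i) =
        kk y * ψ (∑ i, ξ i * (z - y) i) := by
      intro ξ
      rw [mul_assoc, ← AddChar.map_add_eq_mul]
      congr 2
      simp only [Pi.sub_apply, mul_sub, Finset.sum_sub_distrib]
      ring
    simp only [e, ← Finset.mul_sum, h, sub_eq_zero, eq_comm (a := z)]
    split_ifs with hh
    · rw [hh, mul_comm]
    · simp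
  simp [h1]

/-- Fourier transform of a real function -/
noncomputable def ft (ψ : AddChar F ℂ) (f : (Fin d → F) → ℝ) (ξ : Fin d → F) : ℂ :=
  ∑ x, (f x : ℂ) * ψ (∑ i, ξ i * x i)

lemma conj_ft (ψ : AddChar F ℂ) (f : (Fin d → F) → ℝ) (ξ : Fin d → F) :
    (starRingEnd ℂ) (ft ψ f ξ) = ∑ x, (f x : ℂ) * ψ (-∑ i, ξ i * x i) := by
  rw [ft, map_sum]
  refine Finset.sum_congr rfl fun x _ => ?_
  rw [map_mul, Complex.conj_ofReal, AddChar.map_neg_eq_conj]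

lemma parseval (ψ : AddChar F ℂ) (hψ : ψ ≠ 1) (f : (Fin d → F) → ℝ) :
    ∑ ξ, ‖ft ψ f ξ‖ ^ 2 = (Fintype.card F : ℝ) ^ d * ∑ x, f x ^ 2 := by
  have h : ∑ ξ, ft ψ f ξ * (starRingEnd ℂ) (ft ψ f ξ) =
      (Fintype.card F : ℂ) ^ d * ∑ x, (f x : ℂ) ^ 2 := by
    simp only [conj_ft]
    simp only [ft, Finset.sum_mul_sum]
    rw [Finset.sum_comm, Finset.mul_sum]
    refine Finset.sum_congr rfl fun x _ => ?_
    rw [Finset.sum_comm]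
    have h1 : ∀ y : Fin d → F, ∑ ξ : Fin d → F, (f x : ℂ) * ψ (∑ i, ξ i * x i) *
        ((f y : ℂ) * ψ (-∑ i, ξ i * y i)) =
        if y = x then (Fintype.card F : ℂ) ^ d * (f x : ℂ) ^ 2 else 0 := by
      intro y
      have h := ortho ψ hψ (x - y)
      have e : ∀ ξ : Fin d → F, (f x : ℂ) * ψ (∑ i, ξ i * x i) *
        ((f y : ℂ) * ψ (-∑ i, ξ i * y i)) = (f x : ℂ) * f y * ψ (∑ i, ξ i * (x - y) i) := by
        intro ξ
        have : ψ (∑ i, ξ i * (x - y) i) = ψ (∑ i, ξ i * x i) * ψ (-∑ i, ξ i * y i) := by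
          rw [← AddChar.map_add_eq_mul]
          congr 1
          simp only [Pi.sub_apply, mul_sub, Finset.sum_sub_distrib]
          ring
        rw [this]; ring
      simp only [e, ← Finset.mul_sum, h, sub_eq_zero, eq_comm (a := x)]
      split_ifs with hh
      · rw [hh]; ring
      · simp
    simp [h1]
  simp only [Complex.mul_conj, Complex.normSq_eq_norm_sq] at h
  exact_mod_cast h

lemma bilinear (h2 : (2 : F) ≠ 0) (f g : (Fin d → F) → ℝ) :
    ∑ x, ∑ y, (if ∑ i, (x i - y i) ^ 2 = 1 then 1 else 0) * f x * g y ≤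
      (∑ x, f x) * (∑ y, g y) / Fintype.card F +
      2 * Real.sqrt (Fintype.card F) ^ (d + 1) / Fintype.card F *
        (Real.sqrt (∑ x, f x ^ 2) * Real.sqrt (∑ x, g x ^ 2)) := by
  obtain ⟨ψ, hψ1⟩ := AddChar.exists_apply_ne_zero.2 (one_ne_zero : (1 : F) ≠ 0)
  have hψ : ψ ≠ 1 := by rintro rfl; simp at hψ1
  obtain ⟨q, hqdef⟩ : ∃ q : ℝ, q = (Fintype.card F : ℝ) := ⟨_, rfl⟩
  rw [← hqdef]
  have hq : 0 < q := by rw [hqdef]; exact_mod_cast (Fintype.card_pos : 0 < Fintype.card F)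
  set A : ℝ := ∑ x, ∑ y, ((if ∑ i, (x i - y i) ^ 2 = 1 then 1 else 0) - 1 / q) * f x * g y with hA
  have hsplit : ∑ x, ∑ y, (if ∑ i, (x i - y i) ^ 2 = 1 then 1 else 0) * f x * g y =
      (∑ x, f x) * (∑ y, g y) / q + A := by
    rw [hA, Finset.sum_mul_sum, Finset.sum_div, ← Finset.sum_add_distrib]
    refine Finset.sum_congr rfl fun x _ => ?_
    rw [Finset.sum_div, ← Finset.sum_add_distrib]
    refine Finset.sum_congr rfl fun y _ => ?_
    ring
  rw [hsplit]
  have hAc : (A : ℂ) = ∑ x, ∑ y, kk (x - y) * f x * g y := by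
    rw [hA]
    push_cast
    refine Finset.sum_congr rfl fun x _ => Finset.sum_congr rfl fun y _ => ?_
    rw [kk, hqdef]
    simp only [Pi.sub_apply]
    split_ifs <;> simp
  have hqA : (q : ℂ) ^ d * A = ∑ ξ, khat ψ ξ * (ft ψ f ξ * (starRingEnd ℂ) (ft ψ g ξ)) := by
    rw [hAc, Finset.mul_sum]
    simp only [conj_ft]
    simp only [ft, Finset.sum_mul_sum]
    simp only [Finset.mul_sum]
    conv_rhs => rw [Finset.sum_comm]
    refine Finset.sum_congr rfl fun x _ => ?_
    conv_rhs => rw [Finset.sum_comm]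
    refine Finset.sum_congr rfl fun y _ => ?_
    have := kk_inv ψ hψ (x - y)
    rw [hqdef]
    push_cast
    rw [← mul_assoc, ← mul_assoc, this, Finset.sum_mul, Finset.sum_mul]
    refine Finset.sum_congr rfl fun ξ _ => ?_
    have : ψ (∑ i, ξ i * (x - y) i) = ψ (∑ i, ξ i * x i) * ψ (-∑ i, ξ i * y i) := by
      rw [← AddChar.map_add_eq_mul]
      congr 1
      simp only [Pi.sub_apply, mul_sub, Finset.sum_sub_distrib]
      ring
    rw [this]; ring
  set lam : ℝ := 2 * Real.sqrt q ^ (d + 1) / q with hlam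
  have hkb : ∀ ξ : Fin d → F, ‖khat ψ ξ‖ ≤ lam := by
    intro ξ
    rw [hlam, le_div_iff₀ hq, mul_comm]
    rw [hqdef]
    exact khat_bound h2 ψ hψ ξ
  have hlam0 : 0 ≤ lam := by positivity
  have hqd : 0 < q ^ d := pow_pos hq d
  have hfin : q ^ d * A ≤ q ^ d * (lam * (Real.sqrt (∑ x, f x ^ 2) * Real.sqrt (∑ x, g x ^ 2))) := by
    have h1 : q ^ d * A ≤ ‖(q : ℂ) ^ d * A‖ := by
      have : (q : ℂ) ^ d * A = ((q ^ d * A : ℝ) : ℂ) := by push_cast; rfl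
      rw [this, Complex.norm_real]; exact le_abs_self _
    rw [hqA] at h1
    refine h1.trans ((norm_sum_le _ _).trans ?_)
    have h3 : ∀ ξ ∈ (Finset.univ : Finset (Fin d → F)),
        ‖khat ψ ξ * (ft ψ f ξ * (starRingEnd ℂ) (ft ψ g ξ))‖ ≤
        lam * (‖ft ψ f ξ‖ * ‖ft ψ g ξ‖) := by
      intro ξ _
      rw [norm_mul, norm_mul, RCLike.norm_conj]
      exact mul_le_mul_of_nonneg_right (hkb ξ) (by positivity)
    refine (Finset.sum_le_sum h3).trans ?_
    rw [← Finset.mul_sum]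
    have h4 := Real.sum_mul_le_sqrt_mul_sqrt Finset.univ (fun ξ => ‖ft ψ f ξ‖) (fun ξ => ‖ft ψ g ξ‖)
    rw [parseval ψ hψ, parseval ψ hψ, ← hqdef, Real.sqrt_mul hqd.le, Real.sqrt_mul hqd.le] at h4
    have h5 := Real.mul_self_sqrt hqd.le
    calc lam * ∑ ξ, ‖ft ψ f ξ‖ * ‖ft ψ g ξ‖ ≤ lam * _ := mul_le_mul_of_nonneg_left h4 hlam0
      _ = (√(q ^ d) * √(q ^ d)) * (lam * (Real.sqrt (∑ x, f x ^ 2) * Real.sqrt (∑ x, g x ^ 2))) := by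
        ring
      _ = _ := by rw [h5]
  have := le_of_mul_le_mul_left hfin hqd
  linarith

end fourier
end Klo

namespace Klo
section final
variable {F : Type} [Field F] [Fintype F] [DecidableEq F] {d : ℕ}

/-- number of chains of length `n` in `E` starting at `x` -/
noncomputable def aa (E : Finset (Fin d → F)) : ℕ → (Fin d → F) → ℝ
  | 0, x => if x ∈ E then 1 else 0
  | n + 1, x => if x ∈ E then
      ∑ y, (if ∑ i, (x i - y i) ^ 2 = 1 then 1 else 0) * aa E n y else 0

/-- chain predicate -/
def IsChain (E : Finset (Fin d → F)) (n : ℕ) (x : Fin (n + 1) → (Fin d → F)) : Prop :=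
  (∀ i, x i ∈ E) ∧ ∀ i : Fin n, ∑ j, (x i.castSucc j - x i.succ j) ^ 2 = 1

instance (E : Finset (Fin d → F)) (n : ℕ) (x : Fin (n + 1) → (Fin d → F)) :
    Decidable (IsChain E n x) := by unfold IsChain; infer_instance

lemma isChain_cons (E : Finset (Fin d → F)) (n : ℕ) (x : Fin d → F)
    (y : Fin (n + 1) → (Fin d → F)) :
    IsChain E (n + 1) (Fin.cons x y) ↔
      x ∈ E ∧ ∑ j, (x j - y 0 j) ^ 2 = 1 ∧ IsChain E n y := by
  unfold IsChain
  have h1 : (∀ i, (Fin.cons x y : Fin (n + 1 + 1) → (Fin d → F)) i ∈ E) ↔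
      x ∈ E ∧ ∀ i, y i ∈ E := by
    rw [Fin.forall_fin_succ]; simp only [Fin.cons_zero, Fin.cons_succ]
  have h2 : (∀ i : Fin (n + 1), ∑ j, ((Fin.cons x y : Fin (n + 1 + 1) → (Fin d → F)) i.castSucc j -
      (Fin.cons x y : Fin (n + 1 + 1) → (Fin d → F)) i.succ j) ^ 2 = 1) ↔
      ∑ j, (x j - y 0 j) ^ 2 = 1 ∧ ∀ i : Fin n, ∑ j, (y i.castSucc j - y i.succ j) ^ 2 = 1 := by
    rw [Fin.forall_fin_succ]
    simp only [Fin.cons_zero, Fin.cons_succ, Fin.castSucc_zero, ← Fin.succ_castSucc]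
  rw [h1, h2]
  tauto

lemma aa_count (E : Finset (Fin d → F)) (n : ℕ) (x : Fin d → F) :
    aa E n x = ∑ y : Fin n → (Fin d → F),
      if IsChain E n (Fin.cons x y : Fin (n + 1) → (Fin d → F)) then (1 : ℝ) else 0 := by
  induction n generalizing x with
  | zero =>
    simp [aa, IsChain]
  | succ n ih =>
    rw [← (Fin.consEquiv (fun _ : Fin (n + 1) => (Fin d → F))).sum_comp, Fintype.sum_prod_type]
    simp only [aa, ih]
    by_cases hx : x ∈ E
    · simp only [hx, if_true]
      refine Finset.sum_congr rfl fun y _ => ?_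
      rw [Finset.mul_sum]
      refine Finset.sum_congr rfl fun z _ => ?_
      have := isChain_cons E n x (Fin.cons y z)
      simp only [Fin.cons_zero] at this
      change _ = if IsChain E (n + 1) (Fin.cons x (Fin.cons y z : Fin (n + 1) → (Fin d → F)) :
        Fin (n + 1 + 1) → (Fin d → F)) then (1 : ℝ) else 0
      by_cases h1 : ∑ i, (x i - y i) ^ 2 = 1 <;>
      by_cases h2 : IsChain E n (Fin.cons y z : Fin (n + 1) → (Fin d → F)) <;>
      simp [h1, h2, hx, this]
    · simp [hx, isChain_cons]

lemma count_eq (E : Finset (Fin d → F)) (n : ℕ) : (chainCount E n : ℝ) = ∑ x, aa E n x := by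
  have h : chainCount E n = (Finset.univ.filter (fun x => IsChain E n x)).card := by
    unfold chainCount
    congr 1
  rw [h, Finset.card_filter]
  push_cast
  rw [← (Fin.consEquiv (fun _ : Fin (n + 1) => (Fin d → F))).sum_comp, Fintype.sum_prod_type]
  refine Finset.sum_congr rfl fun x _ => ?_
  rw [aa_count]
  rfl

lemma aa_nonneg (E : Finset (Fin d → F)) (n : ℕ) (x : Fin d → F) : 0 ≤ aa E n x := by
  rw [aa_count]
  exact Finset.sum_nonneg fun _ _ => by split_ifs <;> norm_num

lemma aa_supp (E : Finset (Fin d → F)) (n : ℕ) (x : Fin d → F) (hx : x ∉ E) : aa E n x = 0 := by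
  cases n <;> simp [aa, hx]

lemma aa_sum_le (E : Finset (Fin d → F)) (n : ℕ) :
    ∑ x, aa E n x ≤ √(E.card : ℝ) * √(∑ x, aa E n x ^ 2) := by
  have h := Real.sum_mul_le_sqrt_mul_sqrt Finset.univ (fun x => if x ∈ E then (1 : ℝ) else 0)
    (fun x => aa E n x)
  have h1 : ∑ x, (if x ∈ E then (1 : ℝ) else 0) * aa E n x = ∑ x, aa E n x := by
    refine Finset.sum_congr rfl fun x _ => ?_
    by_cases hx : x ∈ E
    · simp [hx]
    · simp [hx, aa_supp]
  have h3 : ∑ x, (if x ∈ E then (1 : ℝ) else 0) ^ 2 = E.card := by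
    simp [ite_pow]
  rw [h1, h3] at h
  exact h

lemma aa_step (h2 : (2 : F) ≠ 0) (E : Finset (Fin d → F)) (n : ℕ) :
    √(∑ x, aa E (n + 1) x ^ 2) ≤
      ((E.card : ℝ) / Fintype.card F + 2 * √(Fintype.card F : ℝ) ^ (d + 1) / Fintype.card F) *
        √(∑ x, aa E n x ^ 2) := by
  have h := bilinear h2 (aa E (n + 1)) (aa E n)
  have e : ∑ x, ∑ y, (if ∑ i, (x i - y i) ^ 2 = 1 then 1 else 0) * aa E (n + 1) x * aa E n y =
      ∑ x, aa E (n + 1) x ^ 2 := by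
    refine Finset.sum_congr rfl fun x _ => ?_
    by_cases hx : x ∈ E
    · have : aa E (n + 1) x = ∑ y, (if ∑ i, (x i - y i) ^ 2 = 1 then 1 else 0) * aa E n y := by
        simp [aa, hx]
      rw [sq]
      nth_rewrite 3 [this]
      rw [Finset.mul_sum]
      exact Finset.sum_congr rfl fun y _ => by ring
    · simp [aa_supp E (n + 1) x hx]
  rw [e] at h
  have s1 := aa_sum_le E (n + 1)
  have s2 := aa_sum_le E n
  have n1 : 0 ≤ ∑ x, aa E n x := Finset.sum_nonneg fun x _ => aa_nonneg E n x
  have hE := Real.mul_self_sqrt (Nat.cast_nonneg (α := ℝ) E.card)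
  have hS : 0 ≤ ∑ x, aa E (n + 1) x ^ 2 := Finset.sum_nonneg fun x _ => sq_nonneg _
  have hX := Real.mul_self_sqrt hS
  set X := √(∑ x, aa E (n + 1) x ^ 2) with hXd
  set Y := √(∑ x, aa E n x ^ 2)
  have hX0 : 0 ≤ X := Real.sqrt_nonneg _
  have hY0 : 0 ≤ Y := Real.sqrt_nonneg _
  have hq : (0 : ℝ) < (Fintype.card F : ℝ) := by
    exact_mod_cast (Fintype.card_pos : 0 < Fintype.card F)
  have hp : (∑ x, aa E (n + 1) x) * (∑ y, aa E n y) ≤ E.card * (X * Y) := by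
    calc _ ≤ (√(E.card : ℝ) * X) * (√(E.card : ℝ) * Y) :=
          mul_le_mul s1 s2 n1 (by positivity)
      _ = (√(E.card : ℝ) * √(E.card : ℝ)) * (X * Y) := by ring
      _ = _ := by rw [hE]
  have hp2 := div_le_div_of_nonneg_right hp hq.le
  have hfin : X * X ≤ X * (((E.card : ℝ) / Fintype.card F +
      2 * √(Fintype.card F : ℝ) ^ (d + 1) / Fintype.card F) * Y) := by
    rw [hX]
    refine h.trans ?_
    calc _ ≤ E.card * (X * Y) / (Fintype.card F : ℝ) +
          2 * √(Fintype.card F : ℝ) ^ (d + 1) / Fintype.card F * (X * Y) := by gcongr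
      _ = _ := by ring
  rcases hX0.eq_or_lt with h0 | h0
  · rw [← h0]; positivity
  · exact le_of_mul_le_mul_left hfin h0

lemma aa_bound (h2 : (2 : F) ≠ 0) (E : Finset (Fin d → F)) (n : ℕ) :
    √(∑ x, aa E n x ^ 2) ≤
      ((E.card : ℝ) / Fintype.card F + 2 * √(Fintype.card F : ℝ) ^ (d + 1) / Fintype.card F) ^ n *
        √(E.card : ℝ) := by
  induction n with
  | zero => simp [aa, ite_pow]
  | succ n ih =>
    refine (aa_step h2 E n).trans ?_
    rw [pow_succ' _ n, mul_assoc]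
    exact mul_le_mul_of_nonneg_left ih (by positivity)

lemma count_bound (h2 : (2 : F) ≠ 0) (E : Finset (Fin d → F)) (n : ℕ) :
    (chainCount E n : ℝ) ≤ E.card *
      ((E.card : ℝ) / Fintype.card F + 2 * √(Fintype.card F : ℝ) ^ (d + 1) / Fintype.card F) ^ n := by
  rw [count_eq]
  refine (aa_sum_le E n).trans ?_
  refine (mul_le_mul_of_nonneg_left (aa_bound h2 E n) (Real.sqrt_nonneg _)).trans ?_
  rw [mul_left_comm, Real.mul_self_sqrt (Nat.cast_nonneg _), mul_comm]

lemma pow_est (n : ℕ) (x : ℝ) (hx : 0 ≤ x) (h : n * x ≤ Real.log 2) :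
    (1 + x) ^ n ≤ 1 + n * x / Real.log 2 := by
  have hl : 0 < Real.log 2 := Real.log_pos (by norm_num)
  have h1 : (1 + x) ^ n ≤ Real.exp (n * x) := by
    rw [Real.exp_nat_mul]
    exact pow_le_pow_left₀ (by positivity) (by linarith [Real.add_one_le_exp x]) n
  refine h1.trans ?_
  set s := n * x / Real.log 2 with hs
  have hs0 : 0 ≤ s := by positivity
  have hs1 : s ≤ 1 := by rw [hs, div_le_one hl]; exact h
  have hc := convexOn_exp.2 (Set.mem_univ (0 : ℝ)) (Set.mem_univ (Real.log 2))
    (sub_nonneg.2 hs1) hs0 (by ring)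
  simp only [smul_eq_mul, mul_zero, zero_add, Real.exp_zero, mul_one,
    Real.exp_log (show (0 : ℝ) < 2 by norm_num)] at hc
  have : s * Real.log 2 = n * x := by rw [hs]; field_simp
  rw [this] at hc
  linarith

end final
end Klo

theorem statement10 {F : Type} [Field F] [Fintype F] [DecidableEq F]
    (q : ℕ) (hq : Fintype.card F = q) (hodd : Odd q)
    (d : ℕ) (hd : 2 ≤ d)
    (E : Finset (Fin d → F)) (n : ℕ)
    (hE : (q : ℝ) ^ (((d : ℝ) + 1) / 2) ≤ (E.card : ℝ) * Real.log 2 / (2 * n)) :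
    (chainCount E n : ℝ) ≤
      (E.card : ℝ) ^ (n + 1) / (q : ℝ) ^ n +
        (2 * (n : ℝ) / Real.log 2) * (q : ℝ) ^ (((d : ℝ) + 1) / 2) *
          ((E.card : ℝ) ^ n / (q : ℝ) ^ n) := by
  have hq0 : (0 : ℝ) < (q : ℝ) := by
    rw [← hq]; exact_mod_cast (Fintype.card_pos : 0 < Fintype.card F)
  have hl : 0 < Real.log 2 := Real.log_pos (by norm_num)
  have h2 : (2 : F) ≠ 0 := by
    intro h
    have hc : ((Fintype.card F : ℕ) : F) = 0 := Nat.cast_card_eq_zero F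
    obtain ⟨k, hk⟩ := hodd
    rw [hq, hk] at hc
    push_cast at hc
    rw [h] at hc
    simp at hc
  have hb := Klo.count_bound h2 E n
  rw [hq] at hb
  have hsq : √(q : ℝ) ^ (d + 1) = (q : ℝ) ^ (((d : ℝ) + 1) / 2) := by
    rw [Real.sqrt_eq_rpow, ← Real.rpow_natCast, ← Real.rpow_mul hq0.le]
    congr 1; push_cast; ring
  rw [hsq] at hb
  have hQ : 0 < (q : ℝ) ^ (((d : ℝ) + 1) / 2) := Real.rpow_pos_of_pos hq0 _
  set Q := (q : ℝ) ^ (((d : ℝ) + 1) / 2)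
  have hn : (0 : ℝ) < n := by
    rcases Nat.eq_zero_or_pos n with h | h
    · subst h; simp at hE; linarith
    · exact_mod_cast h
  rw [le_div_iff₀ (by positivity)] at hE
  have hEc : (0 : ℝ) < E.card := by
    by_contra hcon
    have : 0 < Q * (2 * n) := by positivity
    nlinarith
  generalize (E.card : ℝ) = e at *
  have hx : n * (2 * Q / e) ≤ Real.log 2 := by
    rw [← mul_div_assoc, div_le_iff₀ hEc]; linarith
  have hp := Klo.pow_est n (2 * Q / e) (by positivity) hx
  calc _ ≤ _ := hb
    _ = e ^ (n + 1) / (q : ℝ) ^ n * (1 + 2 * Q / e) ^ n := by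
      have : e / q + 2 * Q / q = e / q * (1 + 2 * Q / e) := by field_simp
      rw [this, mul_pow, div_pow, pow_succ]; ring
    _ ≤ e ^ (n + 1) / (q : ℝ) ^ n * (1 + n * (2 * Q / e) / Real.log 2) :=
      mul_le_mul_of_nonneg_left hp (by positivity)
    _ = _ := by
      rw [pow_succ]; field_simp
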